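/- arXiv:1012.3386 — 4 statements merged into one kernel-verified Lean document; each statement's English description precedes it below -/
import Mathlib

section
/- For the β-biased random walk (β > 1) started at (d,1) on the trap with anchor (d,0), entrance length e and core length c, let T be the first hitting time of (d,0) and let T* = T if the walk does not visit the core vertex (d−e,2) before time T, and T* = 0 otherwise. Let T^∞ be the first hitting time of (d,0) for the β-biased walk started at (d,1) on the infinite-entrance trap, namely the subgraph of ℤ² with edges {(d,0),(d,1)} and all horizontal edges {(d−i−1,1),(d−i,1)} for i ≥ 0. Then T* is stochastically dominated by T^∞ (uniformly: for every choice of d, e and c), and T^∞ has finite expectation. -/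
open MeasureTheory Filter
open scoped ENNReal

noncomputable section

/-- Vertices of the square lattice. -/
abbrev V : Type := ℤ × ℤ

/-- Adjacency in the square lattice ℤ²: Euclidean distance one. -/
def latAdj (u v : V) : Prop := (u.1 - v.1) ^ 2 + (u.2 - v.2) ^ 2 = 1

instance : MeasurableSpace (Sym2 V) := ⊤

open scoped Classical in
/-- One-step transition probability of the β-biased random walk on the subgraph of ℤ²
with edge set `G`: if the set `Λ` of neighbours of `z` is nonempty and contains the right
neighbour `(z.1+1, z.2)`, step to it with probability `β/(β+|Λ|-1)` and to each other
neighbour with probability `1/(β+|Λ|-1)`; if `Λ` does not contain the right neighbour, step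
uniformly in `Λ`; if `Λ` is empty, stay put. -/
def transProb (β : ℝ) (G : Set (Sym2 V)) (z w : V) : ℝ :=
  if {u : V | s(z, u) ∈ G} = ∅ then (if w = z then 1 else 0)
  else
    if s(z, w) ∈ G then
      (if s(z, ((z.1 + 1, z.2) : V)) ∈ G then
        (if w = ((z.1 + 1, z.2) : V) then
          β / (β + ({u : V | s(z, u) ∈ G}.ncard : ℝ) - 1)
        else 1 / (β + ({u : V | s(z, u) ∈ G}.ncard : ℝ) - 1))
      else 1 / ({u : V | s(z, u) ∈ G}.ncard : ℝ))
    else 0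

/-- `μ` is the law of the β-biased random walk on the subgraph of ℤ² with edge set `G`,
started at `z₀`: a probability measure on trajectories whose cylinder probabilities are
the products of the one-step transition probabilities. -/
def IsWalkLaw (β : ℝ) (G : Set (Sym2 V)) (z₀ : V) (μ : Measure (ℕ → V)) : Prop :=
  IsProbabilityMeasure μ ∧
    ∀ (n : ℕ) (f : ℕ → V), f 0 = z₀ →
      μ {ω | ∀ i ≤ n, ω i = f i} =
        ENNReal.ofReal (∏ i ∈ Finset.range n, transProb β G (f i) (f (i + 1)))

/-- The trap with anchor `(d, y)`, entrance length `e` (at height `y+1`, running leftward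
from the anchor) and core length `c` (at height `y+2`, running rightward). -/
def trapEdgesAt (d y : ℤ) (e c : ℕ) : Set (Sym2 V) :=
  {s((d, y), (d, y + 1)), s((d - e, y + 1), (d - e, y + 2))} ∪
    {f | ∃ i : ℕ, i < e ∧ f = s((d - e + i, y + 1), (d - e + i + 1, y + 1))} ∪
    {f | ∃ i : ℕ, i < c ∧ f = s((d - e + i, y + 2), (d - e + i + 1, y + 2))}

/-- First hitting time of the vertex `a` (with value `⊤` if `a` is never visited). -/
def hitTime (ω : ℕ → V) (a : V) : ℕ∞ :=
  sInf {n : ℕ∞ | ∃ t : ℕ, (t : ℕ∞) = n ∧ ω t = a}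

open scoped Classical in
/-- `T*`: the first hitting time of the anchor `(d,0)` if the core vertex `(d-e,2)` is not
visited before that time, and `0` otherwise. -/
def Tstar (d : ℤ) (e : ℕ) (ω : ℕ → V) : ℕ∞ :=
  if ∃ s : ℕ, (s : ℕ∞) < hitTime ω ((d, 0) : V) ∧ ω s = ((d - e, 2) : V) then 0
  else hitTime ω ((d, 0) : V)

/-- The trap with anchor `(d,0)` and an infinite entrance: the vertical edge
`{(d,0),(d,1)}` together with all horizontal edges at height 1 to the left of `(d,1)`. -/
def infTrapEdges (d : ℤ) : Set (Sym2 V) :=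
  {s((d, 0), (d, 1))} ∪ {f | ∃ i : ℕ, f = s((d - i - 1, 1), (d - i, 1))}

lemma integral_comp_le_of_measure_preimage_le {Ω Ω' : Type*} [MeasurableSpace Ω]
    [MeasurableSpace Ω'] {μ : Measure Ω} {ν : Measure Ω'} [IsProbabilityMeasure μ]
    [IsProbabilityMeasure ν] {X : Ω → ℕ∞} {Y : Ω' → ℕ∞} (hX : Measurable X) (hY : Measurable Y)
    (h : ∀ n, n ≠ 0 → μ (X ⁻¹' {n}) ≤ ν (Y ⁻¹' {n})) {f : ℕ∞ → ℝ} (hf : Monotone f)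
    (hb : ∃ M : ℝ, ∀ x, |f x| ≤ M) :
    ∫ ω, f (X ω) ∂μ ≤ ∫ ω, f (Y ω) ∂ν := by
  obtain ⟨M, hM⟩ := hb
  have hfm : Measurable f := measurable_from_top
  have hiX : Integrable (fun ω => f (X ω)) μ :=
    Integrable.of_bound (hfm.comp hX).aestronglyMeasurable M (ae_of_all _ fun _ => hM _)
  have hiY : Integrable (fun ω => f (Y ω)) ν :=
    Integrable.of_bound (hfm.comp hY).aestronglyMeasurable M (ae_of_all _ fun _ => hM _)
  have h0 : ∀ x, 0 ≤ f x - f 0 := fun x => sub_nonneg.2 (hf (zero_le (a := x)))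
  have hg : Measurable fun x => ENNReal.ofReal (f x - f 0) := measurable_from_top
  have key : ∫⁻ ω, ENNReal.ofReal (f (X ω) - f 0) ∂μ ≤ ∫⁻ ω, ENNReal.ofReal (f (Y ω) - f 0) ∂ν := by
    rw [← lintegral_map hg hX, ← lintegral_map hg hY, lintegral_countable', lintegral_countable']
    refine ENNReal.tsum_le_tsum fun n => ?_
    rcases eq_or_ne n 0 with rfl | hn
    · simp
    · rw [Measure.map_apply hX (measurableSet_singleton _),
        Measure.map_apply hY (measurableSet_singleton _)]
      gcongr
      exact h n hn
  rw [← ofReal_integral_eq_lintegral_ofReal (f := fun ω => f (X ω) - f 0)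
      (hiX.sub (integrable_const _)) (ae_of_all _ fun _ => h0 _),
    ← ofReal_integral_eq_lintegral_ofReal (f := fun ω => f (Y ω) - f 0)
      (hiY.sub (integrable_const _)) (ae_of_all _ fun _ => h0 _),
    ENNReal.ofReal_le_ofReal_iff (integral_nonneg fun _ => h0 _),
    integral_sub hiX (integrable_const _), integral_sub hiY (integrable_const _)] at key
  simpa using key

lemma ENat.toENNReal_le_tsum (k : ℕ∞) :
    (k : ℝ≥0∞) ≤ ∑' n : ℕ, {n : ℕ | (n : ℕ∞) < k}.indicator (fun _ => 1) n := by
  induction k using ENat.recTopCoe with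
  | top => simp
  | coe m =>
    refine le_trans ?_ (ENNReal.sum_le_tsum (Finset.range m))
    rw [Finset.sum_congr rfl fun n hn => Set.indicator_of_mem (by simpa using hn) _]
    simp

lemma measure_eq_tsum_inter_preimage {Ω ι : Type*} [MeasurableSpace Ω] [Countable ι]
    [MeasurableSpace ι] [MeasurableSingletonClass ι] (μ : Measure Ω) {X : Ω → ι}
    (hX : Measurable X) (A : Set Ω) :
    μ A = ∑' i, μ (X ⁻¹' {i} ∩ A) := by
  have := tsum_measure_preimage_singleton (μ := μ.restrict A) (f := X) Set.countable_univ
    fun y _ => hX (measurableSet_singleton y)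
  rw [tsum_univ fun i => μ.restrict A (X ⁻¹' {i})] at this
  simp only [Measure.restrict_apply (hX (measurableSet_singleton _)), Set.preimage_univ,
    Measure.restrict_apply_univ] at this
  exact this.symm

lemma lt_hitTime_iff (ω : ℕ → V) (a : V) (n : ℕ) :
    (n : ℕ∞) < hitTime ω a ↔ ∀ i < n + 1, ω i ≠ a := by
  unfold hitTime
  constructor
  · intro h i hi hia
    have : sInf {n : ℕ∞ | ∃ t : ℕ, (t : ℕ∞) = n ∧ ω t = a} ≤ (i : ℕ∞) := sInf_le ⟨i, rfl, hia⟩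
    have h2 := h.trans_le this
    have : n < i := by exact_mod_cast h2
    omega
  · intro h
    have : ((n + 1 : ℕ) : ℕ∞) ≤ sInf {n : ℕ∞ | ∃ t : ℕ, (t : ℕ∞) = n ∧ ω t = a} := by
      refine le_sInf ?_
      rintro _ ⟨t, rfl, ht⟩
      by_contra hc
      refine h t ?_ ht
      exact_mod_cast not_le.1 hc
    exact lt_of_lt_of_le (by exact_mod_cast Nat.lt_succ_self n) this

lemma hitTime_eq_coe_iff (ω : ℕ → V) (a : V) (n : ℕ) :
    hitTime ω a = n ↔ (∀ i < n, ω i ≠ a) ∧ ω n = a := by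
  have h1 : ((n : ℕ∞) < hitTime ω a) ↔ _ := lt_hitTime_iff ω a n
  have h2 : (n : ℕ∞) ≤ hitTime ω a ↔ ∀ i < n, ω i ≠ a := by
    cases n with
    | zero => simp
    | succ m =>
      rw [← lt_hitTime_iff]
      push_cast
      exact ENat.add_one_le_iff (ENat.natCast_ne_top m)
  rw [← h2]
  constructor
  · intro h
    refine ⟨h.ge, ?_⟩
    by_contra hn
    refine (h1.2 fun i hi => ?_).ne' h
    rcases Nat.lt_succ_iff_lt_or_eq.1 hi with hi | rfl
    · exact h2.1 h.ge i hi
    · exact hn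
  · rintro ⟨h, hn⟩
    refine le_antisymm (not_lt.1 fun hlt => ?_) h
    exact h1.1 hlt n (Nat.lt_succ_self n) hn

lemma hitTime_eq_top_iff (ω : ℕ → V) (a : V) : hitTime ω a = ⊤ ↔ ∀ i, ω i ≠ a := by
  simp only [ENat.eq_top_iff_forall_gt, lt_hitTime_iff]
  exact ⟨fun h i => h i i (Nat.lt_succ_self i), fun h _ i _ => h i⟩

lemma measurableSet_eval_eq (i : ℕ) (a : V) : MeasurableSet {ω : ℕ → V | ω i = a} :=
  measurableSet_eq_fun (measurable_pi_apply i) measurable_const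

lemma measurable_hitTime (a : V) : Measurable fun ω : ℕ → V => hitTime ω a := by
  have hne : ∀ i, MeasurableSet {ω : ℕ → V | ω i ≠ a} := fun i =>
    (measurableSet_eval_eq i a).compl
  refine measurable_to_countable' fun k => ?_
  induction k using ENat.recTopCoe with
  | top =>
    have : (fun ω : ℕ → V => hitTime ω a) ⁻¹' {⊤} = ⋂ i, {ω | ω i ≠ a} := by
      ext ω; simp [hitTime_eq_top_iff]
    rw [this]
    exact MeasurableSet.iInter hne
  | coe n =>
    have : (fun ω : ℕ → V => hitTime ω a) ⁻¹' {(n : ℕ∞)} =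
        (⋂ i, ⋂ (_ : i < n), {ω | ω i ≠ a}) ∩ {ω | ω n = a} := by
      ext ω; simp [hitTime_eq_coe_iff]
    rw [this]
    exact (MeasurableSet.iInter fun i => MeasurableSet.iInter fun _ => hne i).inter
      (measurableSet_eval_eq n a)

lemma measurable_Tstar (d : ℤ) (e : ℕ) : Measurable (Tstar d e) := by
  unfold Tstar
  refine Measurable.ite ?_ measurable_const (measurable_hitTime _)
  rw [Set.ofPred_exists]
  refine MeasurableSet.iUnion fun s => ?_
  exact (measurable_hitTime _ (MeasurableSet.of_discrete (s := Set.Ioi (s : ℕ∞)))).inter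
    (measurableSet_eval_eq s _)

lemma transProb_nonneg {β : ℝ} (hβ : 1 < β) (G : Set (Sym2 V)) (z w : V) :
    0 ≤ transProb β G z w := by
  have : (0 : ℝ) ≤ ({u : V | s(z, u) ∈ G}.ncard : ℝ) := Nat.cast_nonneg _
  have h2 : 0 ≤ β + ({u : V | s(z, u) ∈ G}.ncard : ℝ) - 1 := by linarith
  unfold transProb
  split_ifs <;> positivity

lemma transProb_eq_of_right {β : ℝ} {G : Set (Sym2 V)} {z v : V}
    (hN : {u : V | s(z, u) ∈ G} = {(z.1 + 1, z.2), v}) (hv : v ≠ (z.1 + 1, z.2)) (w : V) :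
    transProb β G z w =
      if w = (z.1 + 1, z.2) then β / (β + 1) else if w = v then 1 / (β + 1) else 0 := by
  have hmem : ∀ u, s(z, u) ∈ G ↔ u = (z.1 + 1, z.2) ∨ u = v := fun u => by
    simpa using Set.ext_iff.1 hN u
  unfold transProb
  rw [hN, Set.ncard_pair hv.symm]
  simp only [hmem]
  have : β + ((2 : ℕ) : ℝ) - 1 = β + 1 := by push_cast; ring
  rw [this, if_neg ((Set.insert_nonempty _ _).ne_empty)]
  by_cases h1 : w = (z.1 + 1, z.2)
  · simp [h1]
  · by_cases h2 : w = v <;> simp [h1, h2, hv]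

lemma transProb_eq_of_not_right {β : ℝ} {G : Set (Sym2 V)} {z u v : V}
    (hN : {u : V | s(z, u) ∈ G} = {u, v}) (huv : u ≠ v) (hu : u ≠ (z.1 + 1, z.2))
    (hv : v ≠ (z.1 + 1, z.2)) (w : V) :
    transProb β G z w = if w = u then 1 / 2 else if w = v then 1 / 2 else 0 := by
  have hmem : ∀ x, s(z, x) ∈ G ↔ x = u ∨ x = v := fun x => by
    simpa using Set.ext_iff.1 hN x
  unfold transProb
  rw [hN, Set.ncard_pair huv]
  simp only [hmem]
  rw [if_neg ((Set.insert_nonempty _ _).ne_empty),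
    if_neg (c := (z.1 + 1, z.2) = u ∨ (z.1 + 1, z.2) = v)
    (by simp [hu.symm, hv.symm])]
  by_cases h1 : w = u
  · simp [h1]
  · by_cases h2 : w = v <;> simp [h1, h2]

/-- The probability, under the trajectory law `μ`, of being at `w` at time `n` without having
visited `B` at an earlier time. -/
def avoidProb (μ : Measure (ℕ → V)) (B : Set V) (n : ℕ) (w : V) : ℝ≥0∞ :=
  μ {ω | (∀ i < n, ω i ∉ B) ∧ ω n = w}

lemma IsWalkLaw.measure_start_ne {β : ℝ} {G : Set (Sym2 V)} {z₀ : V} {μ : Measure (ℕ → V)}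
    (h : IsWalkLaw β G z₀ μ) : μ {ω | ω 0 ≠ z₀} = 0 := by
  have := h.1
  have h1 := h.2 0 (fun _ => z₀) rfl
  simp only [Nat.le_zero, forall_eq, Finset.range_zero, Finset.prod_empty,
    ENNReal.ofReal_one] at h1
  exact (prob_compl_eq_zero_iff (measurableSet_eval_eq 0 z₀)).2 h1

lemma IsWalkLaw.avoidProb_zero {β : ℝ} {G : Set (Sym2 V)} {z₀ : V} {μ : Measure (ℕ → V)}
    (h : IsWalkLaw β G z₀ μ) (B : Set V) (w : V) :
    avoidProb μ B 0 w = if w = z₀ then 1 else 0 := by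
  unfold avoidProb
  split_ifs with hw
  · subst hw
    simpa using h.2 0 (fun _ => w) rfl
  · refine measure_mono_null ?_ h.measure_start_ne
    rintro ω ⟨-, h0⟩
    simpa [h0] using hw

lemma IsWalkLaw.measure_cylinder_inter {β : ℝ} (hβ : 1 < β) {G : Set (Sym2 V)} {z₀ : V}
    {μ : Measure (ℕ → V)} (h : IsWalkLaw β G z₀ μ) (n : ℕ) (g : ℕ → V) (w : V) :
    μ {ω | (∀ i ≤ n, ω i = g i) ∧ ω (n + 1) = w} =
      μ {ω | ∀ i ≤ n, ω i = g i} * ENNReal.ofReal (transProb β G (g n) w) := by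
  by_cases h0 : g 0 = z₀
  · have hset : {ω : ℕ → V | (∀ i ≤ n, ω i = g i) ∧ ω (n + 1) = w} =
        {ω | ∀ i ≤ n + 1, ω i = Function.update g (n + 1) w i} := by
      ext ω
      constructor
      · rintro ⟨h1, h2⟩ i hi
        rcases Nat.le_succ_iff.1 hi with hi | rfl
        · rw [Function.update_of_ne (by omega)]
          exact h1 i hi
        · simpa using h2
      · intro h1
        refine ⟨fun i hi => ?_, by simpa using h1 (n + 1) le_rfl⟩
        have := h1 i (by omega)
        rwa [Function.update_of_ne (by omega)] at this
    rw [hset, h.2 (n + 1) _ (by simpa using h0), h.2 n g h0, Finset.prod_range_succ,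
      ENNReal.ofReal_mul (Finset.prod_nonneg fun _ _ => transProb_nonneg hβ _ _ _)]
    congr 2
    · refine Finset.prod_congr rfl fun i hi => ?_
      have := Finset.mem_range.1 hi
      rw [Function.update_of_ne (by omega), Function.update_of_ne (by omega)]
    · simp
  · have h1 : μ {ω | ∀ i ≤ n, ω i = g i} = 0 :=
      measure_mono_null (fun ω hω => by simpa [hω 0 (Nat.zero_le n)] using h0) h.measure_start_ne
    rw [h1, zero_mul]
    exact measure_mono_null (fun ω hω => hω.1) h1

lemma IsWalkLaw.measure_markov {β : ℝ} (hβ : 1 < β) {G : Set (Sym2 V)} {z₀ : V}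
    {μ : Measure (ℕ → V)} (h : IsWalkLaw β G z₀ μ) (B : Set V) (n : ℕ) (z w : V) :
    μ {ω | ((∀ i < n, ω i ∉ B) ∧ ω n = z) ∧ ω (n + 1) = w} =
      avoidProb μ B n z * ENNReal.ofReal (transProb β G z w) := by
  set X : (ℕ → V) → (Fin (n + 1) → V) := fun ω i => ω i with hX
  have hXm : Measurable X := measurable_pi_lambda _ fun i => measurable_pi_apply _
  rw [avoidProb, measure_eq_tsum_inter_preimage μ hXm, measure_eq_tsum_inter_preimage μ hXm,
    ← ENNReal.tsum_mul_right]
  refine tsum_congr fun g => ?_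
  set g' : ℕ → V := fun i => if hi : i < n + 1 then g ⟨i, hi⟩ else z
  have hg : ∀ ω, ω ∈ X ⁻¹' {g} ↔ ∀ i ≤ n, ω i = g' i := by
    intro ω
    simp only [Set.mem_preimage, Set.mem_singleton_iff, funext_iff, hX, g']
    constructor
    · intro hω i hi
      rw [dif_pos (by omega)]
      exact hω ⟨i, by omega⟩
    · intro hω i
      have := hω i (by omega)
      rwa [dif_pos i.2] at this
  by_cases hgood : (∀ i < n, g' i ∉ B) ∧ g' n = z
  · have hiff : ∀ ω : ℕ → V, (∀ i ≤ n, ω i = g' i) → (∀ i < n, ω i ∉ B) ∧ ω n = z :=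
      fun ω hω => ⟨fun i hi => by rw [hω i hi.le]; exact hgood.1 i hi, by rw [hω n le_rfl, hgood.2]⟩
    have e1 : X ⁻¹' {g} ∩ {ω | ((∀ i < n, ω i ∉ B) ∧ ω n = z) ∧ ω (n + 1) = w} =
        {ω | (∀ i ≤ n, ω i = g' i) ∧ ω (n + 1) = w} := by
      ext ω
      rw [Set.mem_inter_iff, hg]
      exact ⟨fun hω => ⟨hω.1, hω.2.2⟩, fun hω => ⟨hω.1, hiff ω hω.1, hω.2⟩⟩
    have e2 : X ⁻¹' {g} ∩ {ω | (∀ i < n, ω i ∉ B) ∧ ω n = z} = {ω | ∀ i ≤ n, ω i = g' i} := by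
      ext ω
      rw [Set.mem_inter_iff, hg]
      exact ⟨fun hω => hω.1, fun hω => ⟨hω, hiff ω hω⟩⟩
    rw [e1, e2, h.measure_cylinder_inter hβ, hgood.2]
  · have e2 : X ⁻¹' {g} ∩ {ω | (∀ i < n, ω i ∉ B) ∧ ω n = z} = ∅ := by
      refine Set.eq_empty_of_forall_notMem fun ω hω => hgood ?_
      have h1 := (hg ω).1 hω.1
      exact ⟨fun i hi => by rw [← h1 i hi.le]; exact hω.2.1 i hi,
        by rw [← h1 n le_rfl]; exact hω.2.2⟩
    have e1 : X ⁻¹' {g} ∩ {ω | ((∀ i < n, ω i ∉ B) ∧ ω n = z) ∧ ω (n + 1) = w} = ∅ :=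
      Set.subset_empty_iff.1 fun ω hω => e2 ▸ ⟨hω.1, hω.2.1⟩
    rw [e1, e2]
    simp

lemma IsWalkLaw.avoidProb_succ {β : ℝ} (hβ : 1 < β) {G : Set (Sym2 V)} {z₀ : V}
    {μ : Measure (ℕ → V)} (h : IsWalkLaw β G z₀ μ) (B : Set V) (n : ℕ) (w : V) :
    avoidProb μ B (n + 1) w =
      ∑' z, Bᶜ.indicator (avoidProb μ B n) z * ENNReal.ofReal (transProb β G z w) := by
  rw [avoidProb, measure_eq_tsum_inter_preimage μ (measurable_pi_apply n)]
  refine tsum_congr fun z => ?_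
  by_cases hz : z ∈ B
  · rw [Set.indicator_of_notMem (by simpa using hz), zero_mul]
    convert measure_empty (μ := μ)
    refine Set.eq_empty_of_forall_notMem fun ω hω => hω.2.1 n (Nat.lt_succ_self n) ?_
    have : ω n = z := hω.1
    rwa [this]
  · rw [Set.indicator_of_mem (by simpa using hz), ← h.measure_markov hβ]
    congr 1
    ext ω
    simp only [Set.mem_inter_iff, Set.mem_preimage, Set.mem_singleton_iff, Set.mem_ofPred_eq]
    constructor
    · rintro ⟨h1, h2, h3⟩
      exact ⟨⟨fun i hi => h2 i (by omega), h1⟩, h3⟩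
    · rintro ⟨⟨h1, h2⟩, h3⟩
      refine ⟨h2, fun i hi => ?_, h3⟩
      rcases Nat.lt_succ_iff_lt_or_eq.1 hi with hi | rfl
      · exact h1 i hi
      · rwa [h2]

lemma measure_avoid_eq_tsum (μ : Measure (ℕ → V)) (B : Set V) (n : ℕ) :
    μ {ω | ∀ i < n + 1, ω i ∉ B} = ∑' z, Bᶜ.indicator (avoidProb μ B n) z := by
  rw [measure_eq_tsum_inter_preimage μ (measurable_pi_apply n)]
  refine tsum_congr fun z => ?_
  by_cases hz : z ∈ B
  · rw [Set.indicator_of_notMem (by simpa using hz)]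
    convert measure_empty (μ := μ)
    refine Set.eq_empty_of_forall_notMem fun ω hω => hω.2 n (Nat.lt_succ_self n) ?_
    have : ω n = z := hω.1
    rwa [this]
  · rw [Set.indicator_of_mem (by simpa using hz), avoidProb]
    congr 1
    ext ω
    simp only [Set.mem_inter_iff, Set.mem_preimage, Set.mem_singleton_iff, Set.mem_ofPred_eq]
    constructor
    · rintro ⟨h1, h2⟩
      exact ⟨fun i hi => h2 i (by omega), h1⟩
    · rintro ⟨h1, h2⟩
      refine ⟨h2, fun i hi => ?_⟩
      rcases Nat.lt_succ_iff_lt_or_eq.1 hi with hi | rfl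
      · exact h1 i hi
      · rwa [h2]

lemma IsWalkLaw.tsum_measure_avoid_le {β : ℝ} (hβ : 1 < β) {G : Set (Sym2 V)} {z₀ : V}
    {μ : Measure (ℕ → V)} (h : IsWalkLaw β G z₀ μ) (B : Set V) {φ : V → ℝ≥0∞}
    (hφB : ∀ z ∈ B, φ z = 0)
    (hφ : ∀ z ∉ B, (∑' w, ENNReal.ofReal (transProb β G z w) * φ w) + 1 ≤ φ z) :
    ∑' n, μ {ω | ∀ i < n + 1, ω i ∉ B} ≤ φ z₀ := by
  have hind : ∀ n w, avoidProb μ B n w * φ w = Bᶜ.indicator (avoidProb μ B n) w * φ w := by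
    intro n w
    by_cases hw : w ∈ B
    · simp [hφB w hw]
    · rw [Set.indicator_of_mem (by simpa using hw)]
  have step : ∀ n, (∑' w, avoidProb μ B (n + 1) w * φ w) + μ {ω | ∀ i < n + 1, ω i ∉ B} ≤
      ∑' w, avoidProb μ B n w * φ w := by
    intro n
    rw [measure_avoid_eq_tsum]
    simp only [h.avoidProb_succ hβ, ← ENNReal.tsum_mul_right]
    rw [ENNReal.tsum_comm, ← ENNReal.tsum_add]
    refine ENNReal.tsum_le_tsum fun z => ?_
    by_cases hz : z ∈ B
    · simp [hz]
    · simp only [mul_assoc, ENNReal.tsum_mul_left]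
      rw [Set.indicator_of_mem (by simpa using hz)]
      calc _ = avoidProb μ B n z * ((∑' w, ENNReal.ofReal (transProb β G z w) * φ w) + 1) := by
            rw [mul_add, mul_one]
        _ ≤ _ := by gcongr; exact hφ z hz
  have total : ∀ N, (∑ n ∈ Finset.range N, μ {ω | ∀ i < n + 1, ω i ∉ B}) +
      ∑' w, avoidProb μ B N w * φ w ≤ φ z₀ := by
    intro N
    induction N with
    | zero => simp [h.avoidProb_zero]
    | succ N ih =>
      rw [Finset.sum_range_succ, add_assoc, add_comm (μ _)]
      exact (add_le_add_right (step N) _).trans ih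
  exact ENNReal.tsum_le_of_sum_range_le fun N => le_self_add.trans (total N)

lemma infTrapEdges_neighbors_end (d : ℤ) :
    {u : V | s(((d, 1) : V), u) ∈ infTrapEdges d} = {(d, 0), (d - 1, 1)} := by
  ext ⟨a, b⟩
  simp only [infTrapEdges, Set.mem_ofPred_eq, Set.mem_union, Set.mem_insert_iff,
    Set.mem_singleton_iff, Sym2.eq_iff, Prod.mk.injEq, and_true, true_and]
  constructor
  · rintro (h | ⟨i, h⟩) <;> omega
  · rintro (h | h)
    · left; omega
    · exact Or.inr ⟨0, by push_cast; omega⟩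

lemma infTrapEdges_neighbors {d x : ℤ} (hx : x < d) :
    {u : V | s(((x, 1) : V), u) ∈ infTrapEdges d} = {(x + 1, 1), (x - 1, 1)} := by
  ext ⟨a, b⟩
  simp only [infTrapEdges, Set.mem_ofPred_eq, Set.mem_union, Set.mem_insert_iff,
    Set.mem_singleton_iff, Sym2.eq_iff, Prod.mk.injEq, and_true]
  constructor
  · rintro (h | ⟨i, h⟩) <;> omega
  · rintro (h | h)
    · exact Or.inr ⟨(d - x - 1).toNat, by omega⟩
    · exact Or.inr ⟨(d - x).toNat, by omega⟩

lemma trapEdgesAt_neighbors_end (d : ℤ) {e c : ℕ} (he : 1 ≤ e) :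
    {u : V | s(((d, 1) : V), u) ∈ trapEdgesAt d 0 e c} = {(d, 0), (d - 1, 1)} := by
  ext ⟨a, b⟩
  simp only [trapEdgesAt, Set.mem_ofPred_eq, Set.mem_union, Set.mem_insert_iff,
    Set.mem_singleton_iff, Sym2.eq_iff, Prod.mk.injEq, true_and]
  constructor
  · rintro (((h | h) | ⟨i, hi, h⟩) | ⟨i, hi, h⟩) <;> omega
  · rintro (h | h)
    · left; left; left; omega
    · exact Or.inl (Or.inr ⟨e - 1, by omega, by omega⟩)

lemma trapEdgesAt_neighbors {d x : ℤ} {e c : ℕ} (hx : x < d) (hx' : d - e < x) :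
    {u : V | s(((x, 1) : V), u) ∈ trapEdgesAt d 0 e c} = {(x + 1, 1), (x - 1, 1)} := by
  ext ⟨a, b⟩
  simp only [trapEdgesAt, Set.mem_ofPred_eq, Set.mem_union, Set.mem_insert_iff,
    Set.mem_singleton_iff, Sym2.eq_iff, Prod.mk.injEq]
  constructor
  · rintro (((h | h) | ⟨i, hi, h⟩) | ⟨i, hi, h⟩) <;> omega
  · rintro (h | h)
    · exact Or.inl (Or.inr ⟨(x - d + e).toNat, by omega, by omega⟩)
    · exact Or.inl (Or.inr ⟨(x - d + e - 1).toNat, by omega, by omega⟩)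

lemma trapEdgesAt_neighbors_corner (d : ℤ) {e c : ℕ} (he : 1 ≤ e) :
    {u : V | s(((d - e, 1) : V), u) ∈ trapEdgesAt d 0 e c} =
      {(d - e + 1, 1), (d - e, 2)} := by
  ext ⟨a, b⟩
  simp only [trapEdgesAt, Set.mem_ofPred_eq, Set.mem_union, Set.mem_insert_iff,
    Set.mem_singleton_iff, Sym2.eq_iff, Prod.mk.injEq, true_and]
  constructor
  · rintro (((h | h) | ⟨i, hi, h⟩) | ⟨i, hi, h⟩) <;> omega
  · rintro (h | h)
    · exact Or.inl (Or.inr ⟨0, by omega, by left; simpa using h⟩)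
    · left; left; right; omega

lemma transProb_infTrapEdges_end (β : ℝ) (d : ℤ) (w : V) :
    transProb β (infTrapEdges d) (d, 1) w =
      if w = (d, 0) then 1 / 2 else if w = (d - 1, 1) then 1 / 2 else 0 :=
  transProb_eq_of_not_right (infTrapEdges_neighbors_end d) (by simp) (by simp)
    (by simp; omega) w

lemma transProb_infTrapEdges (β : ℝ) {d x : ℤ} (hx : x < d) (w : V) :
    transProb β (infTrapEdges d) (x, 1) w =
      if w = (x + 1, 1) then β / (β + 1) else if w = (x - 1, 1) then 1 / (β + 1) else 0 :=
  transProb_eq_of_right (infTrapEdges_neighbors hx) (by simp; omega) w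

/-- The vertices of the entrance of the trap. -/
def entrance (d : ℤ) (e : ℕ) : Set V := {z | z.2 = 1 ∧ d - e ≤ z.1 ∧ z.1 ≤ d}

lemma transProb_trapEdgesAt_le {β : ℝ} (hβ : 1 < β) {d : ℤ} {e c : ℕ} (he : 1 ≤ e) {z w : V}
    (hz : z ∈ entrance d e) (hw : w ≠ (d - e, 2)) :
    transProb β (trapEdgesAt d 0 e c) z w ≤ transProb β (infTrapEdges d) z w := by
  obtain ⟨x, y⟩ := z
  obtain ⟨hy, h1, h2⟩ := hz
  simp only at hy h1 h2
  subst hy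
  rcases h2.lt_or_eq with h2 | rfl
  · rw [transProb_infTrapEdges β h2]
    rcases h1.lt_or_eq with h1 | rfl
    · rw [transProb_eq_of_right (trapEdgesAt_neighbors h2 h1) (by simp; omega)]
    · rw [transProb_eq_of_right (trapEdgesAt_neighbors_corner d he) (by simp), if_neg hw]
      split_ifs
      · exact le_rfl
      · positivity
      · exact le_rfl
  · rw [transProb_infTrapEdges_end, transProb_eq_of_not_right (trapEdgesAt_neighbors_end x he)
      (by simp) (by simp) (by simp; omega)]

lemma mem_entrance_of_transProb_ne_zero {β : ℝ} {d : ℤ} {e c : ℕ} (he : 1 ≤ e) {z w : V}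
    (hz : z ∈ entrance d e) (hw : w ≠ (d - e, 2)) (hw' : w ≠ (d, 0))
    (h : transProb β (trapEdgesAt d 0 e c) z w ≠ 0) : w ∈ entrance d e := by
  obtain ⟨x, y⟩ := z
  obtain ⟨hy, h1, h2⟩ := hz
  simp only at hy h1 h2
  subst hy
  rcases h2.lt_or_eq with h2 | rfl
  · rcases h1.lt_or_eq with h1 | rfl
    · rw [transProb_eq_of_right (trapEdgesAt_neighbors h2 h1) (by simp; omega)] at h
      split_ifs at h with h3 h3
      · subst h3; exact ⟨rfl, by simp; omega, by simp; omega⟩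
      · subst h3; exact ⟨rfl, by simp; omega, by simp; omega⟩
      · exact absurd rfl h
    · rw [transProb_eq_of_right (trapEdgesAt_neighbors_corner d he) (by simp), if_neg hw] at h
      split_ifs at h with h3
      · subst h3; exact ⟨rfl, by simp, by simp; omega⟩
      · exact absurd rfl h
  · rw [transProb_eq_of_not_right (trapEdgesAt_neighbors_end x he)
      (by simp) (by simp) (by simp; omega), if_neg hw'] at h
    split_ifs at h with h3
    · subst h3; exact ⟨rfl, by simp; omega, by simp⟩
    · exact absurd rfl h

lemma avoidProb_trapEdgesAt_le {β : ℝ} (hβ : 1 < β) {d : ℤ} {e c : ℕ} (he : 1 ≤ e)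
    {μ ν : Measure (ℕ → V)} (hμ : IsWalkLaw β (trapEdgesAt d 0 e c) (d, 1) μ)
    (hν : IsWalkLaw β (infTrapEdges d) (d, 1) ν) (n : ℕ) {w : V} (hw : w ≠ (d - e, 2)) :
    avoidProb μ {(d, 0), (d - e, 2)} n w ≤ avoidProb ν {(d, 0)} n w ∧
      (w ≠ (d, 0) → w ∉ entrance d e → avoidProb μ {(d, 0), (d - e, 2)} n w = 0) := by
  induction n generalizing w with
  | zero =>
    rw [hμ.avoidProb_zero, hν.avoidProb_zero]
    refine ⟨le_rfl, fun _ hw' => if_neg ?_⟩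
    rintro rfl
    exact hw' ⟨rfl, by simp, le_rfl⟩
  | succ n ih =>
    rw [hμ.avoidProb_succ hβ, hν.avoidProb_succ hβ]
    refine ⟨ENNReal.tsum_le_tsum fun z => ?_, fun h1 h2 => ENNReal.tsum_eq_zero.2 fun z => ?_⟩
    all_goals
      by_cases hz : z = (d, 0) ∨ z = (d - e, 2)
      · rw [Set.indicator_of_notMem (by simpa [not_and_or, or_iff_not_imp_left] using hz),
          zero_mul]
        try exact zero_le
      push Not at hz
      rw [Set.indicator_of_mem (by simpa using hz)]
      by_cases hze : z ∈ entrance d e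
      swap
      · rw [(ih hz.2).2 hz.1 hze, zero_mul]
        try exact zero_le
    · rw [Set.indicator_of_mem (by simpa using hz.1)]
      exact mul_le_mul' (ih hz.2).1
        (ENNReal.ofReal_le_ofReal (transProb_trapEdgesAt_le hβ he hze hw))
    · rw [show transProb β (trapEdgesAt d 0 e c) z w = 0 from by_contra fun h =>
        h2 (mem_entrance_of_transProb_ne_zero he hze hw h1 h)]
      simp

/-- A Lyapunov function for the walk on the infinite-entrance trap, bounding the expected hitting
time of the anchor. -/
def hittingBound (β : ℝ) (d : ℤ) (z : V) : ℝ≥0∞ :=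
  if z = (d, 0) then 0
  else if z.2 = 1 ∧ z.1 ≤ d then
    ENNReal.ofReal ((β + 1) / (β - 1) * ((d : ℝ) - z.1 + 1) + 2)
  else ⊤

lemma hittingBound_row (β : ℝ) {d x : ℤ} (hx : x ≤ d) :
    hittingBound β d (x, 1) = ENNReal.ofReal ((β + 1) / (β - 1) * ((d : ℝ) - x + 1) + 2) := by
  simp [hittingBound, hx]

lemma tsum_ite_pair {ι : Type*} [DecidableEq ι] {u v : ι} (huv : u ≠ v) (p q : ℝ)
    (φ : ι → ℝ≥0∞) :
    ∑' w, ENNReal.ofReal (if w = u then p else if w = v then q else 0) * φ w =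
      ENNReal.ofReal p * φ u + ENNReal.ofReal q * φ v := by
  rw [tsum_eq_sum (s := {u, v}), Finset.sum_pair huv]
  · simp [huv.symm]
  · intro w hw
    simp only [Finset.mem_insert, Finset.mem_singleton, not_or] at hw
    simp [hw.1, hw.2]

lemma hittingBound_drift {β : ℝ} (hβ : 1 < β) (d : ℤ) {z : V} (hz : z ≠ (d, 0)) :
    (∑' w, ENNReal.ofReal (transProb β (infTrapEdges d) z w) * hittingBound β d w) + 1 ≤
      hittingBound β d z := by
  by_cases h : z.2 = 1 ∧ z.1 ≤ d
  swap
  · simp [hittingBound, hz, h]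
  obtain ⟨x, y⟩ := z
  obtain ⟨hy, hx⟩ := h
  simp only at hy hx
  subst hy
  have hβ' : 0 < β - 1 := by linarith
  have hC : 0 < (β + 1) / (β - 1) := by positivity
  rcases hx.lt_or_eq with hx | rfl
  · have hxd : (x : ℝ) + 1 ≤ d := by exact_mod_cast hx
    simp only [transProb_infTrapEdges β hx]
    rw [tsum_ite_pair (by simp; omega), hittingBound_row β (by omega),
      hittingBound_row β (by omega),
      hittingBound_row β hx.le, ← ENNReal.ofReal_mul (by positivity),
      ← ENNReal.ofReal_mul (by positivity), ← ENNReal.ofReal_one]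
    push_cast
    have p1 : 0 ≤ (β + 1) / (β - 1) * ((d : ℝ) - (x + 1) + 1) + 2 := by
      have := mul_nonneg hC.le (show 0 ≤ (d : ℝ) - (x + 1) + 1 by linarith)
      linarith
    have p2 : 0 ≤ (β + 1) / (β - 1) * ((d : ℝ) - (x - 1) + 1) + 2 := by
      have := mul_nonneg hC.le (show 0 ≤ (d : ℝ) - (x - 1) + 1 by linarith)
      linarith
    rw [← ENNReal.ofReal_add (by positivity) (by positivity),
      ← ENNReal.ofReal_add (by positivity) zero_le_one]
    refine ENNReal.ofReal_le_ofReal (le_of_eq ?_)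
    field_simp
    ring
  · simp only [transProb_infTrapEdges_end]
    rw [tsum_ite_pair (by simp), hittingBound_row β (by omega), hittingBound_row β le_rfl,
      ← ENNReal.ofReal_mul (by positivity), ← ENNReal.ofReal_one]
    push_cast
    have : hittingBound β x (x, 0) = 0 := by simp [hittingBound]
    rw [this, mul_zero, zero_add, ← ENNReal.ofReal_add ?_ zero_le_one]
    · refine ENNReal.ofReal_le_ofReal (le_of_eq ?_)
      ring
    · have : (x : ℝ) - (x - 1) + 1 = 2 := by ring
      rw [this]
      positivity

lemma tsum_measure_lt_hitTime_lt_top {β : ℝ} (hβ : 1 < β) {d : ℤ} {ν : Measure (ℕ → V)}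
    (hν : IsWalkLaw β (infTrapEdges d) (d, 1) ν) :
    ∑' n : ℕ, ν {ω | ∀ i < n + 1, ω i ∉ ({(d, 0)} : Set V)} < ⊤ := by
  refine (hν.tsum_measure_avoid_le hβ _ (φ := hittingBound β d) ?_ fun z hz =>
    hittingBound_drift hβ d hz).trans_lt ?_
  · rintro z rfl
    simp [hittingBound]
  · rw [hittingBound_row β le_rfl]
    exact ENNReal.ofReal_lt_top

lemma Tstar_preimage_coe_subset (d : ℤ) (e : ℕ) {n : ℕ} (hn : n ≠ 0) :
    Tstar d e ⁻¹' {(n : ℕ∞)} ⊆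
      {ω | (∀ i < n, ω i ∉ ({(d, 0), (d - e, 2)} : Set V)) ∧ ω n = (d, 0)} := by
  intro ω hω
  simp only [Set.mem_preimage, Set.mem_singleton_iff, Tstar] at hω
  split_ifs at hω with h
  · exact absurd (by exact_mod_cast hω.symm) hn
  · push Not at h
    have h' := (hitTime_eq_coe_iff _ _ _).1 hω
    refine ⟨fun i hi => ?_, h'.2⟩
    simp only [Set.mem_insert_iff, Set.mem_singleton_iff, not_or]
    exact ⟨h'.1 i hi, h i (by rw [hω]; exact_mod_cast hi)⟩

lemma Tstar_preimage_top_subset (d : ℤ) (e n : ℕ) :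
    Tstar d e ⁻¹' {⊤} ⊆ {ω | ∀ i < n + 1, ω i ∉ ({(d, 0), (d - e, 2)} : Set V)} := by
  intro ω hω i _
  simp only [Set.mem_preimage, Set.mem_singleton_iff, Tstar] at hω
  split_ifs at hω with h
  · exact absurd hω (by simp)
  · push Not at h
    simp only [Set.mem_insert_iff, Set.mem_singleton_iff, not_or]
    exact ⟨(hitTime_eq_top_iff _ _).1 hω i, h i (by rw [hω]; exact ENat.natCast_lt_top i)⟩

lemma measure_Tstar_le {β : ℝ} (hβ : 1 < β) {d : ℤ} {e c : ℕ} (he : 1 ≤ e)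
    {μ ν : Measure (ℕ → V)} (hμ : IsWalkLaw β (trapEdgesAt d 0 e c) (d, 1) μ)
    (hν : IsWalkLaw β (infTrapEdges d) (d, 1) ν) {k : ℕ∞} (hk : k ≠ 0) :
    μ (Tstar d e ⁻¹' {k}) ≤ ν ((fun ω => hitTime ω (d, 0)) ⁻¹' {k}) := by
  induction k using ENat.recTopCoe with
  | top =>
    have hlim := ENNReal.tendsto_atTop_zero_of_tsum_ne_top
      (tsum_measure_lt_hitTime_lt_top hβ hν).ne
    refine (ge_of_tendsto' hlim fun n => ?_).trans zero_le
    refine (measure_mono (Tstar_preimage_top_subset d e n)).trans ?_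
    rw [measure_avoid_eq_tsum, measure_avoid_eq_tsum]
    refine ENNReal.tsum_le_tsum fun z => ?_
    by_cases hz : z = (d, 0) ∨ z = (d - e, 2)
    · rw [Set.indicator_of_notMem (by simpa [not_and_or, or_iff_not_imp_left] using hz)]
      exact zero_le
    · push Not at hz
      rw [Set.indicator_of_mem (by simpa using hz), Set.indicator_of_mem (by simpa using hz.1)]
      exact (avoidProb_trapEdgesAt_le hβ he hμ hν n hz.2).1
  | coe n =>
    refine (measure_mono (Tstar_preimage_coe_subset d e (by exact_mod_cast hk))).trans
      ((avoidProb_trapEdgesAt_le hβ he hμ hν n (by simp)).1.trans (measure_mono ?_))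
    rintro ω ⟨h1, h2⟩
    exact (hitTime_eq_coe_iff _ _ _).2 ⟨h1, h2⟩

lemma lintegral_hitTime_le (ν : Measure (ℕ → V)) (a : V) :
    ∫⁻ ω, (hitTime ω a : ℝ≥0∞) ∂ν ≤
      ∑' n : ℕ, ν {ω | ∀ i < n + 1, ω i ∉ ({a} : Set V)} := by
  have hset : ∀ n : ℕ, {ω : ℕ → V | ∀ i < n + 1, ω i ∉ ({a} : Set V)} =
      (fun ω => hitTime ω a) ⁻¹' Set.Ioi (n : ℕ∞) := by
    intro n
    ext ω
    simp [lt_hitTime_iff]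
  have hm : ∀ n : ℕ, MeasurableSet {ω : ℕ → V | ∀ i < n + 1, ω i ∉ ({a} : Set V)} := fun n => by
    rw [hset]
    exact measurable_hitTime a MeasurableSet.of_discrete
  calc _ ≤ ∫⁻ ω, ∑' n : ℕ,
        {ω : ℕ → V | ∀ i < n + 1, ω i ∉ ({a} : Set V)}.indicator (fun _ => (1 : ℝ≥0∞)) ω ∂ν := by
        refine lintegral_mono fun ω => (ENat.toENNReal_le_tsum _).trans (le_of_eq ?_)
        refine tsum_congr fun n => ?_
        rw [hset]
        rfl
    _ = _ := by
        rw [lintegral_tsum fun n => (measurable_const.indicator (hm n)).aemeasurable]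
        exact tsum_congr fun n => lintegral_indicator_one (hm n)

/-- Lemma 2.4. `T*` for the walk started at `(d,1)` on the trap with anchor `(d,0)`,
entrance length `e` and core length `c` is stochastically dominated (uniformly in `d`, `e`,
`c`) by the hitting time `T^∞` of the anchor for the walk started at `(d,1)` on the
infinite-entrance trap, and `T^∞` has finite expectation. -/
theorem exit_fast_if_core_not_hit (β : ℝ) (hβ : 1 < β) (d : ℤ) (e c : ℕ)
    (he : 1 ≤ e) (hc : 1 ≤ c) (μ ν : Measure (ℕ → V))
    (hμ : IsWalkLaw β (trapEdgesAt d 0 e c) ((d, 1) : V) μ)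
    (hν : IsWalkLaw β (infTrapEdges d) ((d, 1) : V) ν) :
    (∀ f : ℕ∞ → ℝ, Monotone f → (∃ M : ℝ, ∀ x : ℕ∞, |f x| ≤ M) →
        ∫ ω, f (Tstar d e ω) ∂μ ≤ ∫ ω, f (hitTime ω ((d, 0) : V)) ∂ν) ∧
      ∫⁻ ω, (hitTime ω ((d, 0) : V) : ℝ≥0∞) ∂ν < ⊤ := by

  have := hμ.1
  have := hν.1
  exact ⟨fun f hf hb => integral_comp_le_of_measure_preimage_le (measurable_Tstar d e)
      (measurable_hitTime _) (fun _ hk => measure_Tstar_le hβ he hμ hν hk) hf hb,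
    (lintegral_hitTime_le ν _).trans_lt (tsum_measure_lt_hitTime_lt_top hβ hν)⟩

end
end

section
/- For the β-biased random walk (β > 1) started at (d,1) on the trap with anchor (d,0), entrance length e and core length c ≥ 2, the probability that the walk visits (d−e+c−1,2) before visiting the anchor (d,0) is at least (β−1)² / (β(β^{e+1}+β−2)). -/
open MeasureTheory Filter
open scoped ENNReal

noncomputable section

/-- The walk visits `a` before any visit to `b`. -/
def VisitsBefore (ω : ℕ → V) (a b : V) : Prop :=
  ∃ t : ℕ, ω t = a ∧ ∀ s ≤ t, ω s ≠ b

/-- The set of trajectories agreeing with `f` up to time `n`. -/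
def pathCylinder (n : ℕ) (f : ℕ → V) : Set (ℕ → V) := {ω | ∀ i ≤ n, ω i = f i}

lemma measurableSet_pathCylinder (n : ℕ) (f : ℕ → V) : MeasurableSet (pathCylinder n f) := by
  have h : pathCylinder n f = ⋂ i : ℕ, ⋂ _ : i ≤ n, (fun ω : ℕ → V => ω i) ⁻¹' {f i} := by
    ext ω
    simp [pathCylinder]
  rw [h]
  exact MeasurableSet.iInter fun i => MeasurableSet.iInter fun _ =>
    measurable_pi_apply i (measurableSet_singleton _)

/-- The trajectory following `f` up to time `m` and sitting at `w` afterwards. -/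
def extendPath (m : ℕ) (f : ℕ → V) (w : V) : ℕ → V := fun i => if i ≤ m then f i else w

lemma pathCylinder_extendPath (m : ℕ) (f : ℕ → V) (w : V) :
    pathCylinder (m + 1) (extendPath m f w) = {ω | ω ∈ pathCylinder m f ∧ ω (m + 1) = w} := by
  ext ω
  simp only [pathCylinder, extendPath, Set.mem_ofPred_eq]
  constructor
  · intro h
    refine ⟨fun i hi => ?_, ?_⟩
    · simpa [hi] using h i (by omega)
    · simpa using h (m + 1) le_rfl
  · rintro ⟨h, hw⟩ i hi
    split_ifs with him
    · exact h i him
    · obtain rfl : i = m + 1 := by omega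
      exact hw

lemma IsWalkLaw.measure_extendPath {β : ℝ} (hβ : 1 < β) {G : Set (Sym2 V)} {z₀ : V}
    {μ : Measure (ℕ → V)} (hμ : IsWalkLaw β G z₀ μ) (m : ℕ) (f : ℕ → V) (hf : f 0 = z₀) (w : V) :
    μ (pathCylinder (m + 1) (extendPath m f w)) =
      ENNReal.ofReal (transProb β G (f m) w) * μ (pathCylinder m f) := by
  have hprod : ∏ i ∈ Finset.range m,
        transProb β G (extendPath m f w i) (extendPath m f w (i + 1)) =
      ∏ i ∈ Finset.range m, transProb β G (f i) (f (i + 1)) := by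
    refine Finset.prod_congr rfl fun i hi => ?_
    have := Finset.mem_range.1 hi
    simp [extendPath, this.le, Nat.succ_le_of_lt this]
  unfold pathCylinder
  rw [hμ.2 _ _ (by simp [extendPath, hf]), hμ.2 _ _ hf, Finset.prod_range_succ, hprod, mul_comm,
    ENNReal.ofReal_mul (transProb_nonneg hβ _ _ _)]
  simp [extendPath]

/-- For the nearest-neighbour walk on `{0, …, N}` stepping up from `k` with probability `r k`,
the probability to go from `k` to `N` within `n` steps without visiting `0`. -/
def reachWithin (r : ℕ → ℝ) (N : ℕ) : ℕ → ℕ → ℝ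
  | 0, k => if k = N then 1 else 0
  | n + 1, k =>
    if k = N then 1
    else if k = 0 then 0
    else r k * reachWithin r N n (k + 1) + (1 - r k) * reachWithin r N n (k - 1)

section reachWithin

variable {r : ℕ → ℝ} {N : ℕ}

lemma reachWithin_top (n : ℕ) : reachWithin r N n N = 1 := by
  cases n <;> simp [reachWithin]

lemma reachWithin_zero (hN : 0 < N) (n : ℕ) : reachWithin r N n 0 = 0 := by
  cases n <;> simp [reachWithin, hN.ne]

lemma reachWithin_succ {k : ℕ} (hk : 0 < k) (hkN : k < N) (n : ℕ) :
    reachWithin r N (n + 1) k =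
      r k * reachWithin r N n (k + 1) + (1 - r k) * reachWithin r N n (k - 1) := by
  simp [reachWithin, hk.ne', hkN.ne]

lemma reachWithin_nonneg (h0 : ∀ k, 0 ≤ r k) (h1 : ∀ k, r k ≤ 1) (n k : ℕ) :
    0 ≤ reachWithin r N n k := by
  induction n generalizing k with
  | zero => unfold reachWithin; split_ifs <;> norm_num
  | succ n ih =>
    unfold reachWithin
    split_ifs
    · norm_num
    · norm_num
    · exact add_nonneg (mul_nonneg (h0 k) (ih _)) (mul_nonneg (sub_nonneg.2 (h1 k)) (ih _))

lemma reachWithin_le_one (h0 : ∀ k, 0 ≤ r k) (h1 : ∀ k, r k ≤ 1) (n k : ℕ) :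
    reachWithin r N n k ≤ 1 := by
  induction n generalizing k with
  | zero => unfold reachWithin; split_ifs <;> norm_num
  | succ n ih =>
    unfold reachWithin
    split_ifs
    · norm_num
    · norm_num
    · have := mul_le_mul_of_nonneg_left (ih (k + 1)) (h0 k)
      have := mul_le_mul_of_nonneg_left (ih (k - 1)) (sub_nonneg.2 (h1 k))
      linarith

lemma reachWithin_mono (h0 : ∀ k, 0 ≤ r k) (h1 : ∀ k, r k ≤ 1) (k : ℕ) :
    Monotone fun n => reachWithin r N n k := by
  refine monotone_nat_of_le_succ fun n => ?_
  induction n generalizing k with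
  | zero =>
    rcases eq_or_ne k N with rfl | hk
    · simp [reachWithin_top]
    · have := reachWithin_nonneg (N := N) h0 h1 1 k
      simpa [reachWithin, hk] using this
  | succ n ih =>
    unfold reachWithin
    split_ifs
    · norm_num
    · norm_num
    · exact add_le_add (mul_le_mul_of_nonneg_left (ih _) (h0 k))
        (mul_le_mul_of_nonneg_left (ih _) (sub_nonneg.2 (h1 k)))

/-- Gambler's ruin: if `D` solves the balance equations `r k * D k = (1 - r k) * D (k - 1)`
with `D 0 = 1`, then `N` is reached from `1` before `0` with probability `1 / ∑ k < N, D k`. -/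
lemma tendsto_reachWithin_one (h0 : ∀ k, 0 < r k) (h1 : ∀ k, r k ≤ 1) (hN : 0 < N)
    {D : ℕ → ℝ} (hD0 : D 0 = 1) (hD : ∀ k, r (k + 1) * D (k + 1) = (1 - r (k + 1)) * D k) :
    Tendsto (fun n => reachWithin r N n 1) atTop (nhds (1 / ∑ k ∈ Finset.range N, D k)) := by
  have h0' : ∀ k, 0 ≤ r k := fun k => (h0 k).le
  have hlim : ∀ k, ∃ l, Tendsto (fun n => reachWithin r N n k) atTop (nhds l) := fun k =>
    ⟨_, tendsto_atTop_ciSup (reachWithin_mono h0' h1 k)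
      ⟨1, by rintro _ ⟨n, rfl⟩; exact reachWithin_le_one h0' h1 n k⟩⟩
  choose L hL using hlim
  have hL0 : L 0 = 0 := tendsto_nhds_unique (hL 0) (by simp [reachWithin_zero hN])
  have hLN : L N = 1 := tendsto_nhds_unique (hL N) (by simp [reachWithin_top])
  have hharm : ∀ k, k + 1 < N → L (k + 1) = r (k + 1) * L (k + 2) + (1 - r (k + 1)) * L k := by
    intro k hk
    refine tendsto_nhds_unique ((tendsto_add_atTop_iff_nat 1).2 (hL (k + 1))) ?_
    simp only [reachWithin_succ (Nat.succ_pos k) hk]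
    exact ((hL (k + 2)).const_mul _).add ((hL k).const_mul _)
  have hincr : ∀ k, k < N → L (k + 1) - L k = D k * L 1 := by
    intro k
    induction k with
    | zero => intro _; simp [hL0, hD0]
    | succ k ih =>
      intro hk
      refine mul_left_cancel₀ (h0 (k + 1)).ne' ?_
      linear_combination (1 - r (k + 1)) * ih (by omega) - hharm k hk - L 1 * hD k
  have hsum : (∑ k ∈ Finset.range N, D k) * L 1 = 1 := by
    rw [Finset.sum_mul, ← Finset.sum_congr rfl fun k hk => hincr k (Finset.mem_range.1 hk),
      Finset.sum_range_sub, hLN, hL0, sub_zero]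
  rw [← eq_one_div_of_mul_eq_one_right hsum]
  exact hL 1

end reachWithin

/-- If the walk moves along the path `p 0, …, p N` like the nearest-neighbour walk with
up-probabilities `r`, then `reachWithin` bounds from below the conditional probability, given a
past avoiding `p 0`, that `p N` is visited before `p 0`. -/
lemma IsWalkLaw.reachWithin_mul_le {β : ℝ} (hβ : 1 < β) {G : Set (Sym2 V)} {z₀ : V}
    {μ : Measure (ℕ → V)} (hμ : IsWalkLaw β G z₀ μ) {r : ℕ → ℝ} {N : ℕ} (hN : 0 < N) {p : ℕ → V}
    (h0 : ∀ k, 0 ≤ r k) (h1 : ∀ k, r k ≤ 1)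
    (hup : ∀ k, 0 < k → k < N → transProb β G (p k) (p (k + 1)) = r k)
    (hdown : ∀ k, 0 < k → k < N → transProb β G (p k) (p (k - 1)) = 1 - r k)
    (hne : ∀ k, 0 < k → p (k + 1) ≠ p (k - 1)) (hbase : ∀ k, 0 < k → p k ≠ p 0)
    (n m k : ℕ) (f : ℕ → V) (hf : f 0 = z₀) (hk : k ≤ N) (hfm : f m = p k)
    (hav : ∀ i ≤ m, k ≠ 0 → f i ≠ p 0) :
    ENNReal.ofReal (reachWithin r N n k) * μ (pathCylinder m f) ≤
      μ (pathCylinder m f ∩ {ω | VisitsBefore ω (p N) (p 0)}) := by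
  rcases hk.eq_or_lt with rfl | hkN
  · rw [reachWithin_top, ENNReal.ofReal_one, one_mul]
    refine measure_mono fun ω hω => ⟨hω, m, ?_, fun s hs => ?_⟩
    · rw [hω m le_rfl, hfm]
    · rw [hω s hs]
      exact hav s hs hN.ne'
  rcases Nat.eq_zero_or_pos k with rfl | hk0
  · simp [reachWithin_zero hN]
  induction n generalizing m k f with
  | zero => simp [reachWithin, hkN.ne]
  | succ n ih =>
    have ih' : ∀ j, j ≤ N →
        ENNReal.ofReal (reachWithin r N n j) * μ (pathCylinder (m + 1) (extendPath m f (p j))) ≤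
          μ (pathCylinder (m + 1) (extendPath m f (p j)) ∩ {ω | VisitsBefore ω (p N) (p 0)}) := by
      intro j hj
      have hav' : ∀ i ≤ m + 1, j ≠ 0 → extendPath m f (p j) i ≠ p 0 := by
        intro i _ hj0
        unfold extendPath
        split_ifs with him
        · exact hav i him hk0.ne'
        · exact hbase j (Nat.pos_of_ne_zero hj0)
      rcases hj.eq_or_lt with rfl | hjN
      · rw [reachWithin_top, ENNReal.ofReal_one, one_mul]
        refine measure_mono fun ω hω => ⟨hω, m + 1, ?_, fun s hs => ?_⟩
        · rw [hω (m + 1) le_rfl]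
          simp [extendPath]
        · rw [hω s hs]
          exact hav' s hs hN.ne'
      rcases Nat.eq_zero_or_pos j with rfl | hj0
      · simp [reachWithin_zero hN]
      exact ih (m + 1) j (extendPath m f (p j)) (by simp [extendPath, hf]) hj
        (by simp [extendPath]) hav' hjN hj0
    have hu := ih' (k + 1) (by omega)
    have hd := ih' (k - 1) (by omega)
    rw [hμ.measure_extendPath hβ m f hf, hfm, ← mul_assoc,
      ← ENNReal.ofReal_mul (reachWithin_nonneg h0 h1 _ _)] at hu hd
    rw [hup k hk0 hkN] at hu
    rw [hdown k hk0 hkN] at hd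
    rw [reachWithin_succ hk0 hkN, ENNReal.ofReal_add
      (mul_nonneg (h0 k) (reachWithin_nonneg h0 h1 _ _))
      (mul_nonneg (sub_nonneg.2 (h1 k)) (reachWithin_nonneg h0 h1 _ _)), add_mul,
      mul_comm (r k), mul_comm (1 - r k)]
    refine (add_le_add hu hd).trans ?_
    rw [← measure_inter_add_sdiff (pathCylinder m f ∩ _)
      (measurableSet_pathCylinder (m + 1) (extendPath m f (p (k + 1))))]
    simp only [pathCylinder_extendPath]
    refine add_le_add (measure_mono ?_) (measure_mono ?_)
    · rintro ω ⟨⟨hω, h⟩, hv⟩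
      exact ⟨⟨hω, hv⟩, hω, h⟩
    · rintro ω ⟨⟨hω, h⟩, hv⟩
      exact ⟨⟨hω, hv⟩, fun h' => hne k hk0 (h'.2.symm.trans h)⟩

section transProb

variable {β : ℝ} {G : Set (Sym2 V)} {z x y : V}

lemma transProb_right_of_two (hG : {u : V | s(z, u) ∈ G} = {x, y}) (hxy : x ≠ y)
    (hx : x = (z.1 + 1, z.2)) : transProb β G z x = β / (β + 1) := by
  have hxG : s(z, x) ∈ G := by
    have : x ∈ {u : V | s(z, u) ∈ G} := by simp [hG]
    exact this
  have hne : ({x, y} : Set V) ≠ ∅ := (Set.insert_nonempty _ _).ne_empty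
  unfold transProb
  rw [hG, if_neg hne, if_pos hxG, ← hx, if_pos hxG, if_pos rfl, Set.ncard_pair hxy]
  congr 1
  push_cast
  ring

lemma transProb_other_of_two (hG : {u : V | s(z, u) ∈ G} = {x, y}) (hxy : x ≠ y)
    (hx : x = (z.1 + 1, z.2)) : transProb β G z y = 1 / (β + 1) := by
  have hxG : s(z, x) ∈ G := by
    have : x ∈ {u : V | s(z, u) ∈ G} := by simp [hG]
    exact this
  have hyG : s(z, y) ∈ G := by
    have : y ∈ {u : V | s(z, u) ∈ G} := by simp [hG]
    exact this
  have hne : ({x, y} : Set V) ≠ ∅ := (Set.insert_nonempty _ _).ne_empty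
  unfold transProb
  rw [hG, if_neg hne, if_pos hyG, ← hx, if_pos hxG, if_neg hxy.symm, Set.ncard_pair hxy]
  congr 1
  push_cast
  ring

lemma transProb_of_two (hG : {u : V | s(z, u) ∈ G} = {x, y}) (hxy : x ≠ y)
    (hx : x ≠ (z.1 + 1, z.2)) (hy : y ≠ (z.1 + 1, z.2)) : transProb β G z x = 1 / 2 := by
  have hxG : s(z, x) ∈ G := by
    have : x ∈ {u : V | s(z, u) ∈ G} := by simp [hG]
    exact this
  have hrG : s(z, ((z.1 + 1, z.2) : V)) ∉ G := by
    intro h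
    have h' : ((z.1 + 1, z.2) : V) ∈ {u : V | s(z, u) ∈ G} := h
    rw [hG] at h'
    rcases h' with h' | h'
    · exact hx h'.symm
    · exact hy h'.symm
  have hne : ({x, y} : Set V) ≠ ∅ := (Set.insert_nonempty _ _).ne_empty
  unfold transProb
  rw [hG, if_neg hne, if_pos hxG, if_neg hrG, Set.ncard_pair hxy]
  norm_num

end transProb

lemma mem_trapEdgesAt_iff (d x y x' y' : ℤ) (e c : ℕ) :
    s(((x, y) : V), ((x', y') : V)) ∈ trapEdgesAt d 0 e c ↔
      (x = d ∧ x' = d ∧ (y = 0 ∧ y' = 1 ∨ y = 1 ∧ y' = 0)) ∨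
      (x = d - e ∧ x' = d - e ∧ (y = 1 ∧ y' = 2 ∨ y = 2 ∧ y' = 1)) ∨
      (y = 1 ∧ y' = 1 ∧ ((x' = x + 1 ∧ d - e ≤ x ∧ x < d) ∨
        (x = x' + 1 ∧ d - e ≤ x' ∧ x' < d))) ∨
      (y = 2 ∧ y' = 2 ∧ ((x' = x + 1 ∧ d - e ≤ x ∧ x < d - e + c) ∨
        (x = x' + 1 ∧ d - e ≤ x' ∧ x' < d - e + c))) := by
  simp only [trapEdgesAt, Set.mem_union, Set.mem_insert_iff, Set.mem_singleton_iff,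
    Set.mem_ofPred_eq, Sym2.eq_iff, Prod.mk.injEq]
  constructor
  · rintro (((h | h) | ⟨i, hi, h⟩) | ⟨i, hi, h⟩)
    · left; omega
    · right; left; omega
    · right; right; left; omega
    · right; right; right; omega
  · rintro (h | h | ⟨hy, hy', h | h⟩ | ⟨hy, hy', h | h⟩)
    · exact .inl (.inl (.inl (by omega)))
    · exact .inl (.inl (.inr (by omega)))
    · exact .inl (.inr ⟨(x - (d - e)).toNat, by omega, .inl (by omega)⟩)
    · exact .inl (.inr ⟨(x' - (d - e)).toNat, by omega, .inr (by omega)⟩)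
    · exact .inr ⟨(x - (d - e)).toNat, by omega, .inl (by omega)⟩
    · exact .inr ⟨(x' - (d - e)).toNat, by omega, .inr (by omega)⟩

/-- The vertices of the trap, listed from the anchor to the end of the core. -/
def trapVertex (d : ℤ) (e k : ℕ) : V :=
  if k = 0 then (d, 0) else if k ≤ e + 1 then (d - k + 1, 1) else (d - e + (k - e - 2), 2)

lemma trapVertex_injective (d : ℤ) (e : ℕ) : Function.Injective (trapVertex d e) := by
  intro k l h
  unfold trapVertex at h
  split_ifs at h <;> simp only [Prod.mk.injEq] at h <;> omega

set_option maxHeartbeats 2000000 in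
lemma trap_neighbors (d : ℤ) {e c k : ℕ} (hk : 0 < k) (hk' : k < e + c + 2) :
    {u : V | s(trapVertex d e k, u) ∈ trapEdgesAt d 0 e c} =
      {trapVertex d e (k + 1), trapVertex d e (k - 1)} := by
  ext ⟨x, y⟩
  simp only [Set.mem_ofPred_eq, Set.mem_insert_iff, Set.mem_singleton_iff]
  unfold trapVertex
  split_ifs <;> first
    | contradiction
    | (rw [mem_trapEdgesAt_iff, Prod.mk.injEq, Prod.mk.injEq]; omega)

/-- Probability to step from the `k`-th trap vertex towards the end of the core. -/
def trapUpProb (β : ℝ) (e k : ℕ) : ℝ :=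
  if k ≤ 1 then 1 / 2 else if k ≤ e + 1 then 1 / (β + 1) else β / (β + 1)

lemma trapUpProb_pos {β : ℝ} (hβ : 1 < β) (e k : ℕ) : 0 < trapUpProb β e k := by
  unfold trapUpProb
  split_ifs <;> positivity

lemma trapUpProb_le_one {β : ℝ} (hβ : 1 < β) (e k : ℕ) : trapUpProb β e k ≤ 1 := by
  have : 0 < β + 1 := by linarith
  unfold trapUpProb
  split_ifs
  · norm_num
  · rw [div_le_one this]; linarith
  · rw [div_le_one this]; linarith

lemma transProb_trap {β : ℝ} (hβ : 1 < β) (d : ℤ) {e c k : ℕ} (he : 1 ≤ e) (hk : 0 < k)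
    (hk' : k < e + c + 2) :
    transProb β (trapEdgesAt d 0 e c) (trapVertex d e k) (trapVertex d e (k + 1)) =
        trapUpProb β e k ∧
      transProb β (trapEdgesAt d 0 e c) (trapVertex d e k) (trapVertex d e (k - 1)) =
        1 - trapUpProb β e k := by
  have hne : trapVertex d e (k + 1) ≠ trapVertex d e (k - 1) := fun h => by
    have := trapVertex_injective d e h
    omega
  have hG := trap_neighbors d (c := c) hk hk'
  have hG' := hG.trans (Set.pair_comm _ _)
  have hβ' : β + 1 ≠ 0 := by linarith
  unfold trapUpProb
  split_ifs with hk1 hke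
  · obtain rfl : k = 1 := by omega
    have hx : trapVertex d e (1 + 1) ≠
        ((trapVertex d e 1).1 + 1, (trapVertex d e 1).2) := by
      simp [trapVertex, he]
    have hy : trapVertex d e (1 - 1) ≠
        ((trapVertex d e 1).1 + 1, (trapVertex d e 1).2) := by
      simp [trapVertex]
    rw [transProb_of_two hG hne hx hy, transProb_of_two hG' hne.symm hy hx]
    norm_num
  · have hy : trapVertex d e (k - 1) = ((trapVertex d e k).1 + 1, (trapVertex d e k).2) := by
      unfold trapVertex
      split_ifs <;> first | contradiction | (simp only [Prod.mk.injEq, and_true]; omega)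
    rw [transProb_other_of_two hG' hne.symm hy, transProb_right_of_two hG' hne.symm hy]
    refine ⟨rfl, ?_⟩
    field_simp
    ring
  · have hx : trapVertex d e (k + 1) = ((trapVertex d e k).1 + 1, (trapVertex d e k).2) := by
      unfold trapVertex
      split_ifs <;> first | contradiction | (simp only [Prod.mk.injEq, and_true]; omega)
    rw [transProb_other_of_two hG hne hx, transProb_right_of_two hG hne hx]
    refine ⟨rfl, ?_⟩
    field_simp
    ring

/-- Resistance of the edge between the `k`-th and the `k + 1`-st trap vertex. -/
def trapResistance (β : ℝ) (e k : ℕ) : ℝ :=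
  if k ≤ e + 1 then β ^ (k - 1) else β ^ e / β ^ (k - e - 1)

lemma trapResistance_balance {β : ℝ} (hβ : 1 < β) (e k : ℕ) :
    trapUpProb β e (k + 1) * trapResistance β e (k + 1) =
      (1 - trapUpProb β e (k + 1)) * trapResistance β e k := by
  have hβ' : β + 1 ≠ 0 := by linarith
  have hβ0 : β ≠ 0 := by linarith
  unfold trapUpProb trapResistance
  rcases Nat.eq_zero_or_pos k with rfl | hk
  · norm_num
  obtain ⟨k, rfl⟩ : ∃ j, k = j + 1 := ⟨k - 1, by omega⟩
  rcases lt_trichotomy (k + 1) (e + 1) with h | h | h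
  · have h1 : k + 1 + 1 ≤ e + 1 := by omega
    simp only [h1, h.le, if_true, Nat.add_sub_cancel, show ¬ k + 1 + 1 ≤ 1 by omega, if_false]
    field_simp
    ring
  · obtain rfl : k = e := by omega
    simp only [le_refl, if_true, Nat.add_sub_cancel, show ¬ k + 1 + 1 ≤ 1 by omega,
      show ¬ k + 1 + 1 ≤ k + 1 by omega, if_false, show k + 1 + 1 - k - 1 = 1 by omega]
    field_simp
    ring
  · obtain ⟨j, rfl⟩ : ∃ j, k = e + 1 + j := ⟨k - e - 1, by omega⟩
    simp only [show ¬ e + 1 + j + 1 + 1 ≤ 1 by omega, show ¬ e + 1 + j + 1 + 1 ≤ e + 1 by omega,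
      show ¬ e + 1 + j + 1 ≤ e + 1 by omega, if_false,
      show e + 1 + j + 1 + 1 - e - 1 = j + 2 by omega, show e + 1 + j + 1 - e - 1 = j + 1 by omega]
    field_simp
    ring

lemma sum_trapResistance {β : ℝ} (hβ : 1 < β) (e m : ℕ) :
    ∑ k ∈ Finset.range (e + 2 + m), trapResistance β e k =
      1 + (β ^ (e + 1) - 1) / (β - 1) + β ^ e * (1 - 1 / β ^ m) / (β - 1) := by
  have hβ1 : β - 1 ≠ 0 := by linarith
  have hβ0 : β ≠ 0 := by linarith
  induction m with
  | zero =>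
    rw [add_zero, Finset.sum_range_succ', ← geom_sum_eq hβ.ne', add_comm]
    have : ∀ k ∈ Finset.range (e + 1), trapResistance β e (k + 1) = β ^ k := by
      intro k hk
      have := Finset.mem_range.1 hk
      simp [trapResistance, show k ≤ e by omega]
    rw [Finset.sum_congr rfl this]
    simp [trapResistance]
  | succ m ih =>
    rw [← add_assoc, Finset.sum_range_succ, ih]
    simp only [trapResistance, show ¬ e + 2 + m ≤ e + 1 by omega, if_false,
      show e + 2 + m - e - 1 = m + 1 by omega]
    field_simp
    ring

lemma bound_le_inv_sum_trapResistance {β : ℝ} (hβ : 1 < β) (e m : ℕ) :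
    (β - 1) ^ 2 / (β * (β ^ (e + 1) + β - 2)) ≤
      1 / ∑ k ∈ Finset.range (e + 2 + m), trapResistance β e k := by
  have hβ1 : 0 < β - 1 := by linarith
  have hm : 0 < β ^ m := by positivity
  have he : 1 ≤ β ^ e := one_le_pow₀ hβ.le
  have he' : 1 ≤ β ^ (e + 1) := one_le_pow₀ hβ.le
  have hm1 : 0 ≤ 1 - 1 / β ^ m := by
    rw [sub_nonneg, div_le_one hm]
    exact one_le_pow₀ hβ.le
  have hpos : 0 < ∑ k ∈ Finset.range (e + 2 + m), trapResistance β e k := by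
    rw [sum_trapResistance hβ]
    have : 0 ≤ (β ^ (e + 1) - 1) / (β - 1) := div_nonneg (by linarith) hβ1.le
    positivity
  have hle : (∑ k ∈ Finset.range (e + 2 + m), trapResistance β e k) * (β - 1) ≤
      β ^ (e + 1) + β ^ e + β - 2 := by
    rw [sum_trapResistance hβ, add_mul, add_mul, div_mul_cancel₀ _ hβ1.ne',
      div_mul_cancel₀ _ hβ1.ne']
    have : 0 ≤ β ^ e * (1 / β ^ m) := by positivity
    linarith
  rw [div_le_div_iff₀ (mul_pos (by linarith) (by linarith)) hpos, pow_two]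
  have := mul_le_mul_of_nonneg_right hle hβ1.le
  rw [pow_succ] at this ⊢
  nlinarith

/-- The β-biased walk started at `(d,1)` on the trap with anchor `(d,0)`, entrance length
`e` and core length `c ≥ 2` reaches the second-to-last core vertex `(d-e+c-1,2)` before the
anchor `(d,0)` with probability at least `(β-1)²/(β(β^{e+1}+β-2))`. -/
theorem reach_deep_core (β : ℝ) (hβ : 1 < β) (d : ℤ) (e c : ℕ) (he : 1 ≤ e) (hc : 2 ≤ c)
    (μ : Measure (ℕ → V)) (hμ : IsWalkLaw β (trapEdgesAt d 0 e c) ((d, 1) : V) μ) :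
    ENNReal.ofReal ((β - 1) ^ 2 / (β * (β ^ (e + 1) + β - 2))) ≤
      μ {ω | VisitsBefore ω ((d - e + c - 1, 2) : V) ((d, 0) : V)} := by
  obtain ⟨m, rfl⟩ : ∃ m, c = m + 1 := ⟨c - 1, by omega⟩
  have hlim := tendsto_reachWithin_one (trapUpProb_pos hβ e) (trapUpProb_le_one hβ e)
    (N := e + 2 + m) (by omega) (D := trapResistance β e) (by simp [trapResistance])
    (trapResistance_balance hβ e)
  refine (ENNReal.ofReal_le_ofReal (bound_le_inv_sum_trapResistance hβ e m)).trans ?_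
  refine le_of_tendsto' (ENNReal.tendsto_ofReal hlim) fun n => ?_
  have hinj := trapVertex_injective d e
  have key := hμ.reachWithin_mul_le hβ (N := e + 2 + m) (by omega) (p := trapVertex d e)
    (fun k => (trapUpProb_pos hβ e k).le) (trapUpProb_le_one hβ e)
    (fun k hk hkN => (transProb_trap hβ d he hk (by omega)).1)
    (fun k hk hkN => (transProb_trap hβ d he hk (by omega)).2)
    (fun k hk h => by have := hinj h; omega) (fun k hk => hinj.ne hk.ne')
    n 0 1 (fun _ => (d, 1)) rfl (by omega) (by simp [trapVertex]) (by simp [trapVertex])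
  have hone : μ (pathCylinder 0 fun _ => (d, 1)) = 1 := by
    have := hμ.2 0 (fun _ => (d, 1)) rfl
    simpa [pathCylinder] using this
  have htop : trapVertex d e (e + 2 + m) = (d - e + (m + 1 : ℕ) - 1, 2) := by
    simp only [trapVertex, show ¬ e + 2 + m = 0 by omega, show ¬ e + 2 + m ≤ e + 1 by omega,
      if_false, Prod.mk.injEq, and_true]
    omega
  have hzero : trapVertex d e 0 = (d, 0) := by simp [trapVertex]
  rw [hone, mul_one, htop, hzero] at key
  exact key.trans (measure_mono Set.inter_subset_right)

end
end

section
/- In the warm-up configuration with parameter α > 0, for every n such that the trap anchored at (d_n,0) = (n³,0) is present, the probability that the β-biased random walk (β > 1) started at the origin ever visits the core vertex (d_n−e_n, 2) of the n'th trap is at most 1/(β^{e_n+1}+β−2). -/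
open MeasureTheory Filter
open scoped ENNReal

noncomputable section

/-- Anchors of the warm-up traps: `d_n = n³`. -/
def dWarm (n : ℕ) : ℤ := (n : ℤ) ^ 3

/-- Entrance lengths of the warm-up traps: `e_n = ⌈α · log n⌉`. -/
def eWarm (α : ℝ) (n : ℕ) : ℕ := ⌈α * Real.log n⌉₊

/-- Core lengths of the warm-up traps: `c_n = n`. -/
def cWarm (n : ℕ) : ℕ := n

/-- The warm-up configuration: the nonnegative x-axis together with, for every `n ≥ n₀`,
the trap with anchor `(n³, 0)`, entrance length `⌈α log n⌉` and core length `n`. -/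
def warmupEdges (α : ℝ) (n₀ : ℕ) : Set (Sym2 V) :=
  {f | ∃ k : ℕ, f = s(((k : ℤ), 0), ((k : ℤ) + 1, 0))} ∪
    ⋃ n ∈ {m : ℕ | n₀ ≤ m}, trapEdgesAt (dWarm n) 0 (eWarm α n) (cWarm n)

/-- `n₀` is large enough that the traps present in the warm-up configuration are pairwise
disjoint: for `n₀ ≤ m < n`, both the anchor of trap `m` and the right end of its core lie
strictly to the left of the leftmost point of trap `n`. -/
def WarmupSeparated (α : ℝ) (n₀ : ℕ) : Prop :=
  ∀ m n : ℕ, n₀ ≤ m → m < n →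
    dWarm m < dWarm n - eWarm α n ∧ dWarm m - eWarm α m + cWarm m < dWarm n - eWarm α n

/-- The four lattice neighbours of a vertex. -/
def latNbrs (z : V) : Finset V :=
  {(z.1 + 1, z.2), (z.1 - 1, z.2), (z.1, z.2 + 1), (z.1, z.2 - 1)}

open scoped Classical in
/-- The unnormalised weight of the step from `z` to `w`. -/
def stepWeight (β : ℝ) (G : Set (Sym2 V)) (z w : V) : ℝ :=
  if s(z, w) ∈ G then (if w = ((z.1 + 1, z.2) : V) then β else 1) else 0

lemma sum_stepWeight (β : ℝ) (G : Set (Sym2 V)) (z : V)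
    (hG : ∀ w, s(z, w) ∈ G → w ∈ latNbrs z) :
    ∑ w ∈ latNbrs z, stepWeight β G z w =
      ({u : V | s(z, u) ∈ G}.ncard : ℝ) +
        stepWeight (β - 1) G z ((z.1 + 1, z.2) : V) := by
  classical
  have hΛ : {u : V | s(z, u) ∈ G} = ↑((latNbrs z).filter fun w => s(z, w) ∈ G) := by
    ext w
    simpa using hG w
  have hR : ((z.1 + 1, z.2) : V) ∈ latNbrs z := by simp [latNbrs]
  rw [hΛ, Set.ncard_coe_finset, Finset.card_filter]
  have hsplit : ∀ w, stepWeight β G z w =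
      ((if s(z, w) ∈ G then 1 else 0 : ℕ) : ℝ) +
        if w = ((z.1 + 1, z.2) : V) then stepWeight (β - 1) G z w else 0 := by
    intro w
    unfold stepWeight
    split_ifs <;> simp
  rw [Finset.sum_congr rfl fun w _ => hsplit w, Finset.sum_add_distrib]
  rw [Finset.sum_ite_eq' (latNbrs z) ((z.1 + 1, z.2) : V), if_pos hR]
  push_cast
  rfl

lemma transProb_eq_div (β : ℝ) (G : Set (Sym2 V)) (z : V)
    (hG : ∀ w, s(z, w) ∈ G → w ∈ latNbrs z) (hne : {u : V | s(z, u) ∈ G} ≠ ∅) (w : V) :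
    transProb β G z w =
      stepWeight β G z w / ∑ u ∈ latNbrs z, stepWeight β G z u := by
  rw [sum_stepWeight β G z hG, transProb, if_neg hne]
  unfold stepWeight
  by_cases hw : s(z, w) ∈ G
  · by_cases hR : s(z, ((z.1 + 1, z.2) : V)) ∈ G
    · have hadd : β + ({u : V | s(z, u) ∈ G}.ncard : ℝ) - 1 =
          ({u : V | s(z, u) ∈ G}.ncard : ℝ) + (β - 1) := by ring
      simp only [hw, hR, if_true, hadd]
      split_ifs <;> rfl
    · have hwR : w ≠ ((z.1 + 1, z.2) : V) := by
        rintro rfl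
        exact hR hw
      simp [hw, hR, hwR]
  · simp [hw]

/-- A nonnegative function whose weighted drift at `z` is nonpositive is superharmonic at `z`. -/
lemma tsum_transProb_mul_le {β : ℝ} (hβ : 1 < β) (G : Set (Sym2 V)) (z : V)
    (hG : ∀ w, s(z, w) ∈ G → w ∈ latNbrs z) {h : V → ℝ} (h0 : ∀ w, 0 ≤ h w)
    (hdrift : ∑ w ∈ latNbrs z, stepWeight β G z w * (h w - h z) ≤ 0) :
    ∑' w, ENNReal.ofReal (transProb β G z w) * ENNReal.ofReal (h w) ≤
      ENNReal.ofReal (h z) := by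
  classical
  have hnn : ∀ w, 0 ≤ stepWeight β G z w := by
    intro w
    unfold stepWeight
    split_ifs <;> linarith
  by_cases hne : {u : V | s(z, u) ∈ G} = ∅
  · rw [tsum_eq_single z]
    · simp [transProb, hne]
    · intro w hw
      simp [transProb, hne, hw]
  · have hout : ∀ w ∉ latNbrs z, stepWeight β G z w = 0 := fun w hw =>
      if_neg fun hwG => hw (hG w hwG)
    have hpos : 0 < ∑ u ∈ latNbrs z, stepWeight β G z u := by
      obtain ⟨u, hu⟩ := Set.nonempty_iff_ne_empty.mpr hne
      refine Finset.sum_pos' (fun w _ => hnn w) ⟨u, hG u hu, ?_⟩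
      have hu' : s(z, u) ∈ G := hu
      simp only [stepWeight, hu', if_true]
      split_ifs <;> linarith
    rw [tsum_eq_sum (s := latNbrs z)]
    · have hterm : ∀ w ∈ latNbrs z,
          ENNReal.ofReal (transProb β G z w) * ENNReal.ofReal (h w) =
            ENNReal.ofReal
              (stepWeight β G z w * h w / ∑ u ∈ latNbrs z, stepWeight β G z u) := by
        intro w _
        rw [transProb_eq_div β G z hG hne, ← ENNReal.ofReal_mul (div_nonneg (hnn w) hpos.le)]
        congr 1
        ring
      rw [Finset.sum_congr rfl hterm, ← ENNReal.ofReal_sum_of_nonneg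
        fun w _ => div_nonneg (mul_nonneg (hnn w) (h0 w)) hpos.le]
      refine ENNReal.ofReal_le_ofReal ?_
      rw [← Finset.sum_div, div_le_iff₀ hpos]
      simp only [mul_sub, Finset.sum_sub_distrib, ← Finset.sum_mul] at hdrift
      linarith
    · intro w hw
      rw [transProb_eq_div β G z hG hne, hout w hw]
      simp

/-- Finite-horizon hitting bound, conditionally on a cylinder. -/
lemma IsWalkLaw.mul_measure_cylinder_hit_le {β : ℝ} (hβ : 1 < β) {G : Set (Sym2 V)} {z₀ : V}
    {μ : Measure (ℕ → V)} (hμ : IsWalkLaw β G z₀ μ) (T : V) (h : V → ℝ≥0∞)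
    (hsuper : ∀ z, z ≠ T → ∑' w, ENNReal.ofReal (transProb β G z w) * h w ≤ h z)
    (N : ℕ) : ∀ (k : ℕ) (f : ℕ → V), f 0 = z₀ →
      h T * μ {ω | (∀ i ≤ k, ω i = f i) ∧ ∃ t, k ≤ t ∧ t ≤ k + N ∧ ω t = T} ≤
        μ {ω | ∀ i ≤ k, ω i = f i} * h (f k) := by
  induction N with
  | zero =>
    intro k f _
    by_cases hT : f k = T
    · rw [hT, mul_comm]
      exact mul_le_mul_left (measure_mono fun ω hω => hω.1) _
    · have hempty : {ω : ℕ → V | (∀ i ≤ k, ω i = f i) ∧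
          ∃ t, k ≤ t ∧ t ≤ k + 0 ∧ ω t = T} = ∅ := by
        refine Set.eq_empty_of_forall_notMem ?_
        rintro ω ⟨hω, t, h1, h2, h3⟩
        obtain rfl : t = k := by omega
        exact hT ((hω t le_rfl).symm.trans h3)
      rw [hempty, measure_empty, mul_zero]
      exact zero_le
  | succ N ih =>
    intro k f hf
    by_cases hT : f k = T
    · rw [hT, mul_comm]
      exact mul_le_mul_left (measure_mono fun ω hω => hω.1) _
    let g : V → ℕ → V := fun w => Function.update f (k + 1) w
    have hg0 : ∀ w, g w 0 = z₀ := fun w => by simp [g, hf]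
    have hgk : ∀ w, g w (k + 1) = w := fun w => by simp [g]
    have hgle : ∀ w, ∀ i ≤ k, g w i = f i := fun w i hi =>
      Function.update_of_ne (by omega) _ _
    have hcyl : ∀ w, μ {ω | ∀ i ≤ k + 1, ω i = g w i} =
        μ {ω | ∀ i ≤ k, ω i = f i} * ENNReal.ofReal (transProb β G (f k) w) := by
      intro w
      rw [hμ.2 (k + 1) (g w) (hg0 w), hμ.2 k f hf, Finset.prod_range_succ,
        ENNReal.ofReal_mul (Finset.prod_nonneg fun i _ => transProb_nonneg hβ G _ _),
        hgk, hgle w k le_rfl]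
      congr 2
      refine Finset.prod_congr rfl fun i hi => ?_
      have hi' := Finset.mem_range.mp hi
      rw [hgle w i (by omega), hgle w (i + 1) (by omega)]
    have hsub : {ω : ℕ → V | (∀ i ≤ k, ω i = f i) ∧
          ∃ t, k ≤ t ∧ t ≤ k + (N + 1) ∧ ω t = T} ⊆
        ⋃ w, {ω | (∀ i ≤ k + 1, ω i = g w i) ∧
          ∃ t, k + 1 ≤ t ∧ t ≤ k + 1 + N ∧ ω t = T} := by
      rintro ω ⟨hω, t, h1, h2, h3⟩
      have htk : t ≠ k := by
        rintro rfl
        exact hT ((hω t le_rfl).symm.trans h3)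
      refine Set.mem_iUnion.mpr ⟨ω (k + 1), fun i hi => ?_, t, by omega, by omega, h3⟩
      rcases Nat.lt_or_ge k i with hki | hki
      · obtain rfl : i = k + 1 := by omega
        exact (hgk _).symm
      · rw [hgle _ i hki, hω i hki]
    calc h T * μ {ω | (∀ i ≤ k, ω i = f i) ∧ ∃ t, k ≤ t ∧ t ≤ k + (N + 1) ∧ ω t = T}
        ≤ h T * ∑' w, μ {ω | (∀ i ≤ k + 1, ω i = g w i) ∧
            ∃ t, k + 1 ≤ t ∧ t ≤ k + 1 + N ∧ ω t = T} := by
          gcongr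
          exact (measure_mono hsub).trans (measure_iUnion_le _)
      _ = ∑' w, h T * μ {ω | (∀ i ≤ k + 1, ω i = g w i) ∧
            ∃ t, k + 1 ≤ t ∧ t ≤ k + 1 + N ∧ ω t = T} := ENNReal.tsum_mul_left.symm
      _ ≤ ∑' w, μ {ω | ∀ i ≤ k, ω i = f i} *
            (ENNReal.ofReal (transProb β G (f k) w) * h w) := by
          refine ENNReal.tsum_le_tsum fun w => ?_
          have hw := ih (k + 1) (g w) (hg0 w)
          rwa [hcyl, hgk, mul_assoc] at hw
      _ = μ {ω | ∀ i ≤ k, ω i = f i} *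
            ∑' w, ENNReal.ofReal (transProb β G (f k) w) * h w := ENNReal.tsum_mul_left
      _ ≤ μ {ω | ∀ i ≤ k, ω i = f i} * h (f k) := by
          gcongr
          exact hsuper _ hT

/-- A function superharmonic off `T` bounds the probability of ever visiting `T`. -/
lemma IsWalkLaw.mul_measure_hit_le {β : ℝ} (hβ : 1 < β) {G : Set (Sym2 V)} {z₀ : V}
    {μ : Measure (ℕ → V)} (hμ : IsWalkLaw β G z₀ μ) (T : V) (h : V → ℝ≥0∞)
    (hsuper : ∀ z, z ≠ T → ∑' w, ENNReal.ofReal (transProb β G z w) * h w ≤ h z) :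
    h T * μ {ω | ∃ t, ω t = T} ≤ h z₀ := by
  have : IsProbabilityMeasure μ := hμ.1
  have hstart : μ {ω | ω 0 = z₀} = 1 := by
    simpa using hμ.2 0 (fun _ => z₀) rfl
  have hmeas : MeasurableSet {ω : ℕ → V | ω 0 = z₀} :=
    measurableSet_eq_fun (measurable_pi_apply 0) measurable_const
  have hnull : μ {ω | ω 0 = z₀}ᶜ = 0 := (prob_compl_eq_zero_iff hmeas).mpr hstart
  let E : ℕ → Set (ℕ → V) := fun N =>
    {ω | (∀ i ≤ 0, ω i = z₀) ∧ ∃ t, 0 ≤ t ∧ t ≤ 0 + N ∧ ω t = T}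
  have hE : Monotone E := by
    rintro a b hab ω ⟨h0, t, h1, h2, h3⟩
    exact ⟨h0, t, h1, by omega, h3⟩
  have hsub : {ω | ∃ t, ω t = T} ⊆ (⋃ N, E N) ∪ {ω : ℕ → V | ω 0 = z₀}ᶜ := by
    rintro ω ⟨t, ht⟩
    by_cases h0 : ω 0 = z₀
    · refine Or.inl (Set.mem_iUnion.mpr ⟨t, fun i hi => ?_, t, by omega, by omega, ht⟩)
      obtain rfl : i = 0 := by omega
      exact h0
    · exact Or.inr h0
  have hle : μ {ω | ∃ t, ω t = T} ≤ ⨆ N, μ (E N) := by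
    rw [← hE.measure_iUnion]
    calc _ ≤ μ ((⋃ N, E N) ∪ {ω : ℕ → V | ω 0 = z₀}ᶜ) := measure_mono hsub
      _ ≤ μ (⋃ N, E N) + μ {ω : ℕ → V | ω 0 = z₀}ᶜ := measure_union_le _ _
      _ = μ (⋃ N, E N) := by rw [hnull, add_zero]
  calc h T * μ {ω | ∃ t, ω t = T} ≤ h T * ⨆ N, μ (E N) := by gcongr
    _ = ⨆ N, h T * μ (E N) := ENNReal.mul_iSup ..
    _ ≤ h z₀ := iSup_le fun N =>
      (hμ.mul_measure_cylinder_hit_le hβ T h hsuper N 0 (fun _ => z₀) rfl).trans <| by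
        calc _ ≤ 1 * h z₀ := by
              gcongr
              exact prob_le_one
          _ = h z₀ := one_mul _

/-- The column `x` meets the warm-up trap with index `m`. -/
def MeetsTrap (α : ℝ) (m : ℕ) (x : ℤ) : Prop :=
  dWarm m - eWarm α m ≤ x ∧ (x ≤ dWarm m ∨ x ≤ dWarm m - eWarm α m + cWarm m)

lemma WarmupSeparated.eq_of_meetsTrap {α : ℝ} {n₀ : ℕ} (hsep : WarmupSeparated α n₀)
    {m m' : ℕ} (hm : n₀ ≤ m) (hm' : n₀ ≤ m') {x : ℤ} (h : MeetsTrap α m x)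
    (h' : MeetsTrap α m' x) : m = m' := by
  obtain ⟨h1, h2⟩ := h
  obtain ⟨h1', h2'⟩ := h'
  rcases lt_trichotomy m m' with hlt | heq | hlt
  · have := hsep m m' hm hlt
    omega
  · exact heq
  · have := hsep m' m hm' hlt
    omega

lemma mem_warmupEdges_horizontal (α : ℝ) (n₀ : ℕ) (x y : ℤ) :
    s(((x, y) : V), ((x + 1, y) : V)) ∈ warmupEdges α n₀ ↔
      (y = 0 ∧ 0 ≤ x) ∨ ∃ m, n₀ ≤ m ∧
        ((y = 1 ∧ dWarm m - eWarm α m ≤ x ∧ x < dWarm m) ∨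
          (y = 2 ∧ dWarm m - eWarm α m ≤ x ∧ x < dWarm m - eWarm α m + cWarm m)) := by
  simp only [warmupEdges, trapEdgesAt, Set.mem_union, Set.mem_ofPred_eq, Set.mem_iUnion,
    Set.mem_insert_iff, Set.mem_singleton_iff, Sym2.eq_iff, Prod.mk.injEq, exists_prop]
  constructor
  · rintro (⟨k, hk⟩ | ⟨m, hm, ((h | h) | ⟨i, hi, h⟩) | ⟨i, hi, h⟩⟩)
    · left; omega
    · omega
    · omega
    · right; exact ⟨m, hm, by omega⟩
    · right; exact ⟨m, hm, by omega⟩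
  · rintro (⟨h1, h2⟩ | ⟨m, hm, ⟨h1, h2, h3⟩ | ⟨h1, h2, h3⟩⟩)
    · left; exact ⟨x.toNat, by omega⟩
    · refine Or.inr ⟨m, hm, Or.inl (Or.inr ⟨(x - (dWarm m - eWarm α m)).toNat, ?_⟩)⟩
      omega
    · refine Or.inr ⟨m, hm, Or.inr ⟨(x - (dWarm m - eWarm α m)).toNat, ?_⟩⟩
      omega

lemma mem_warmupEdges_vertical (α : ℝ) (n₀ : ℕ) (x y : ℤ) :
    s(((x, y) : V), ((x, y + 1) : V)) ∈ warmupEdges α n₀ ↔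
      ∃ m, n₀ ≤ m ∧
        ((y = 0 ∧ x = dWarm m) ∨ (y = 1 ∧ x = dWarm m - eWarm α m)) := by
  simp only [warmupEdges, trapEdgesAt, Set.mem_union, Set.mem_ofPred_eq, Set.mem_iUnion,
    Set.mem_insert_iff, Set.mem_singleton_iff, Sym2.eq_iff, Prod.mk.injEq, exists_prop]
  constructor
  · rintro (⟨k, hk⟩ | ⟨m, hm, ((h | h) | ⟨i, hi, h⟩) | ⟨i, hi, h⟩⟩)
    · omega
    · exact ⟨m, hm, by omega⟩
    · exact ⟨m, hm, by omega⟩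
    · omega
    · omega
  · rintro ⟨m, hm, h | h⟩
    · exact Or.inr ⟨m, hm, Or.inl (Or.inl (by omega))⟩
    · exact Or.inr ⟨m, hm, Or.inl (Or.inl (by omega))⟩

lemma mem_warmupEdges_left (α : ℝ) (n₀ : ℕ) (x y : ℤ) :
    s(((x, y) : V), ((x - 1, y) : V)) ∈ warmupEdges α n₀ ↔
      (y = 0 ∧ 1 ≤ x) ∨ ∃ m, n₀ ≤ m ∧
        ((y = 1 ∧ dWarm m - eWarm α m < x ∧ x ≤ dWarm m) ∨
          (y = 2 ∧ dWarm m - eWarm α m < x ∧ x ≤ dWarm m - eWarm α m + cWarm m)) := by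
  have h := mem_warmupEdges_horizontal α n₀ (x - 1) y
  rw [sub_add_cancel, Sym2.eq_swap] at h
  rw [h]
  refine or_congr (by omega) (exists_congr fun m => and_congr_right fun _ => ?_)
  omega

lemma mem_warmupEdges_down (α : ℝ) (n₀ : ℕ) (x y : ℤ) :
    s(((x, y) : V), ((x, y - 1) : V)) ∈ warmupEdges α n₀ ↔
      ∃ m, n₀ ≤ m ∧
        ((y = 1 ∧ x = dWarm m) ∨ (y = 2 ∧ x = dWarm m - eWarm α m)) := by
  have h := mem_warmupEdges_vertical α n₀ x (y - 1)
  rw [sub_add_cancel, Sym2.eq_swap] at h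
  rw [h]
  refine exists_congr fun m => and_congr_right fun _ => ?_
  omega

lemma mem_latNbrs_of_mem_warmupEdges {α : ℝ} {n₀ : ℕ} {z w : V}
    (h : s(z, w) ∈ warmupEdges α n₀) : w ∈ latNbrs z := by
  obtain ⟨x, y⟩ := z
  obtain ⟨x', y'⟩ := w
  simp only [warmupEdges, trapEdgesAt, Set.mem_union, Set.mem_ofPred_eq, Set.mem_iUnion,
    Set.mem_insert_iff, Set.mem_singleton_iff, Sym2.eq_iff, Prod.mk.injEq, exists_prop] at h
  simp only [latNbrs, Finset.mem_insert, Finset.mem_singleton, Prod.mk.injEq]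
  rcases h with ⟨k, hk⟩ | ⟨m, hm, ((h | h) | ⟨i, hi, h⟩) | ⟨i, hi, h⟩⟩ <;> omega

/-- The escape profile along the x-axis: constant up to `d`, geometrically decaying beyond. -/
def axisProfile (β : ℝ) (d x : ℤ) : ℝ := if x ≤ d then 1 else β ^ (d - x)

open scoped Classical in
/-- The (unnormalised) harmonic function for hitting the `n`'th core: it follows
`axisProfile` on the axis, is constant on every other trap, and follows the effective
resistance inside the `n`'th trap. -/
def corePotential (α β : ℝ) (n₀ n : ℕ) (z : V) : ℝ :=
  if z.2 = 0 then axisProfile β (dWarm n) z.1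
  else if MeetsTrap α n z.1 then
    (if z.2 = 1 then β ^ (dWarm n - z.1) + β - 1 else β ^ (eWarm α n + 1) + β - 1)
  else if h : ∃ m, n₀ ≤ m ∧ MeetsTrap α m z.1 then axisProfile β (dWarm n) (dWarm h.choose)
  else 1

lemma axisProfile_nonneg {β : ℝ} (hβ : 1 < β) (d x : ℤ) : 0 ≤ axisProfile β d x := by
  unfold axisProfile
  split_ifs <;> positivity

lemma corePotential_nonneg {β : ℝ} (hβ : 1 < β) (α : ℝ) (n₀ n : ℕ) (z : V) :
    0 ≤ corePotential α β n₀ n z := by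
  unfold corePotential
  have h1 : 0 < β ^ (dWarm n - z.1) := by positivity
  have h2 : 0 < β ^ (eWarm α n + 1) := by positivity
  split_ifs
  · exact axisProfile_nonneg hβ _ _
  · linarith
  · linarith
  · exact axisProfile_nonneg hβ _ _
  · exact zero_le_one

lemma corePotential_axis (α β : ℝ) (n₀ n : ℕ) (x : ℤ) :
    corePotential α β n₀ n (x, 0) = axisProfile β (dWarm n) x := by
  simp [corePotential]

lemma corePotential_entrance {α : ℝ} {n : ℕ} {x : ℤ} (h : MeetsTrap α n x) (β : ℝ) (n₀ : ℕ) :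
    corePotential α β n₀ n (x, 1) = β ^ (dWarm n - x) + β - 1 := by
  simp [corePotential, h]

lemma corePotential_core {α : ℝ} {n : ℕ} {x : ℤ} (h : MeetsTrap α n x) (β : ℝ) (n₀ : ℕ) :
    corePotential α β n₀ n (x, 2) = β ^ (eWarm α n + 1) + β - 1 := by
  simp [corePotential, h]

lemma WarmupSeparated.corePotential_of_ne {α : ℝ} {n₀ n m : ℕ} (hsep : WarmupSeparated α n₀)
    (hn : n₀ ≤ n) (hm : n₀ ≤ m) (hmn : m ≠ n) {x y : ℤ} (hx : MeetsTrap α m x) (hy : y ≠ 0)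
    (β : ℝ) : corePotential α β n₀ n (x, y) = axisProfile β (dWarm n) (dWarm m) := by
  have hex : ∃ m, n₀ ≤ m ∧ MeetsTrap α m x := ⟨m, hm, hx⟩
  have hnot : ¬ MeetsTrap α n x := fun h => hmn (hsep.eq_of_meetsTrap hm hn hx h)
  have hch : hex.choose = m :=
    hsep.eq_of_meetsTrap hex.choose_spec.1 hm hex.choose_spec.2 hx
  simp only [corePotential, hy, hnot, hex, if_false, dif_pos, hch]

lemma axisProfile_drift {β : ℝ} (hβ : 1 < β) (d x : ℤ) :
    β * (axisProfile β d (x + 1) - axisProfile β d x) +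
      (axisProfile β d (x - 1) - axisProfile β d x) = if x = d then 1 - β else 0 := by
  have hβ0 : β ≠ 0 := by positivity
  unfold axisProfile
  rcases lt_trichotomy x d with h | rfl | h
  · simp [show x + 1 ≤ d by omega, show x ≤ d by omega, show x - 1 ≤ d by omega,
      show x ≠ d by omega]
  · simp [show x - (x + 1) = -1 by ring]
    field_simp
  · have h1 : (if x - 1 ≤ d then 1 else β ^ (d - (x - 1))) = β ^ (d - x) * β := by
      rw [← zpow_add_one₀ hβ0]
      split_ifs
      · rw [show d - x + 1 = 0 by omega, zpow_zero]
      · congr 1; ring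
    have h2 : β ^ (d - (x + 1)) = β ^ (d - x) * β⁻¹ := by
      rw [← zpow_sub_one₀ hβ0]
      congr 1; ring
    rw [h1, if_neg (by omega), if_neg (by omega), if_neg (by omega), h2]
    field_simp
    ring

lemma sum_latNbrs (x y : ℤ) (F : V → ℝ) :
    ∑ w ∈ latNbrs (x, y), F w = F (x + 1, y) + F (x - 1, y) + F (x, y + 1) + F (x, y - 1) := by
  rw [latNbrs, Finset.sum_insert, Finset.sum_insert, Finset.sum_insert, Finset.sum_singleton]
  · ring
  all_goals
    simp only [Finset.mem_insert, Finset.mem_singleton, Prod.mk.injEq]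
    omega

open scoped Classical in
lemma drift_eq (β : ℝ) (G : Set (Sym2 V)) (x y : ℤ) (h : V → ℝ) :
    ∑ w ∈ latNbrs (x, y), stepWeight β G (x, y) w * (h w - h (x, y)) =
      (if s(((x, y) : V), ((x + 1, y) : V)) ∈ G then β * (h (x + 1, y) - h (x, y)) else 0) +
      (if s(((x, y) : V), ((x - 1, y) : V)) ∈ G then h (x - 1, y) - h (x, y) else 0) +
      (if s(((x, y) : V), ((x, y + 1) : V)) ∈ G then h (x, y + 1) - h (x, y) else 0) +
      (if s(((x, y) : V), ((x, y - 1) : V)) ∈ G then h (x, y - 1) - h (x, y) else 0) := by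
  rw [sum_latNbrs]
  simp [stepWeight, show x - 1 ≠ x + 1 by omega]

lemma WarmupSeparated.axis_drift_le {α β : ℝ} {n₀ n : ℕ} (hsep : WarmupSeparated α n₀)
    (hn₀ : 1 ≤ n₀) (hn : n₀ ≤ n) (hβ : 1 < β) (x : ℤ) :
    ∑ w ∈ latNbrs (x, 0), stepWeight β (warmupEdges α n₀) (x, 0) w *
      (corePotential α β n₀ n w - corePotential α β n₀ n (x, 0)) ≤ 0 := by
  classical
  have hd : 1 ≤ dWarm n := by
    unfold dWarm
    exact_mod_cast Nat.one_le_pow 3 n (by omega)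
  have hdrift := axisProfile_drift hβ (dWarm n) x
  have hanchor : ∀ m, MeetsTrap α m (dWarm m) := fun m => ⟨by omega, Or.inl le_rfl⟩
  have hup : (if s(((x, 0) : V), ((x, 0 + 1) : V)) ∈ warmupEdges α n₀ then
      corePotential α β n₀ n (x, 0 + 1) - corePotential α β n₀ n (x, 0) else 0) =
      if x = dWarm n then β - 1 else 0 := by
    by_cases hx : ∃ m, n₀ ≤ m ∧ x = dWarm m
    · obtain ⟨m, hm, rfl⟩ := hx
      rw [if_pos ((mem_warmupEdges_vertical _ _ _ _).mpr ⟨m, hm, by omega⟩), zero_add,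
        corePotential_axis]
      by_cases hmn : m = n
      · subst hmn
        rw [corePotential_entrance (hanchor m)]
        simp [axisProfile]
      · have hne : dWarm m ≠ dWarm n := fun h =>
          hmn (hsep.eq_of_meetsTrap hm hn (hanchor m) (h ▸ hanchor n))
        rw [hsep.corePotential_of_ne hn hm hmn (hanchor m) one_ne_zero, if_neg hne, sub_self]
    · have hxn : x ≠ dWarm n := fun h => hx ⟨n, hn, h⟩
      rw [if_neg, if_neg hxn]
      rw [mem_warmupEdges_vertical]
      rintro ⟨m, hm, h⟩
      exact hx ⟨m, hm, by omega⟩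
  have hdown : s(((x, 0) : V), ((x, 0 - 1) : V)) ∉ warmupEdges α n₀ := by
    rw [mem_warmupEdges_down]
    rintro ⟨m, hm, h⟩
    omega
  rw [drift_eq, hup, if_neg hdown, add_zero]
  simp only [mem_warmupEdges_horizontal, mem_warmupEdges_left, corePotential_axis]
  by_cases hx : 1 ≤ x
  · rw [if_pos (Or.inl ⟨trivial, by omega⟩), if_pos (Or.inl ⟨trivial, hx⟩), hdrift]
    split_ifs <;> linarith
  · have hflat : ∀ x' ≤ 1, axisProfile β (dWarm n) x' = 1 := fun x' hx' =>
      if_pos (by omega)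
    rw [hflat x (by omega), hflat (x + 1) (by omega), hflat (x - 1) (by omega),
      if_neg (show x ≠ dWarm n by omega)]
    simp

lemma WarmupSeparated.entrance_drift_le {α β : ℝ} {n₀ n : ℕ} (hsep : WarmupSeparated α n₀)
    (hn : n₀ ≤ n) (hβ : 1 < β) (x : ℤ) :
    ∑ w ∈ latNbrs (x, 1), stepWeight β (warmupEdges α n₀) (x, 1) w *
      (corePotential α β n₀ n w - corePotential α β n₀ n (x, 1)) ≤ 0 := by
  classical
  have hβ0 : β ≠ 0 := by positivity
  rw [drift_eq]
  simp only [mem_warmupEdges_horizontal, mem_warmupEdges_left, mem_warmupEdges_vertical,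
    mem_warmupEdges_down, one_ne_zero, false_and, false_or, true_and, OfNat.one_ne_ofNat,
    or_false]
  norm_num only
  by_cases hx : ∃ m, n₀ ≤ m ∧ dWarm m - eWarm α m ≤ x ∧ x ≤ dWarm m
  swap
  · have hnone : ∀ P : ℕ → Prop, (∀ m, P m → dWarm m - eWarm α m ≤ x ∧ x ≤ dWarm m) →
        ¬ ∃ m, n₀ ≤ m ∧ P m := fun P hP ⟨m, hm, h⟩ => hx ⟨m, hm, hP m h⟩
    rw [if_neg (hnone _ fun m h => by omega), if_neg (hnone _ fun m h => by omega),
      if_neg (hnone _ fun m h => by omega), if_neg (hnone _ fun m h => by omega)]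
    simp
  obtain ⟨m, hm, hx⟩ := hx
  have hmeet : ∀ k, dWarm k - eWarm α k ≤ x → x ≤ dWarm k → MeetsTrap α k x :=
    fun k h1 h2 => ⟨h1, Or.inl h2⟩
  have honly : ∀ P : ℕ → Prop, (∀ k, P k → dWarm k - eWarm α k ≤ x ∧ x ≤ dWarm k) →
      ((∃ k, n₀ ≤ k ∧ P k) ↔ P m) := by
    refine fun P hP => ⟨?_, fun h => ⟨m, hm, h⟩⟩
    rintro ⟨k, hk, h⟩
    have hkm := hsep.eq_of_meetsTrap hk hm (hmeet k (hP k h).1 (hP k h).2)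
      (hmeet m hx.1 hx.2)
    exact hkm ▸ h
  rw [if_congr (honly _ fun k h => by omega) rfl rfl,
    if_congr (honly _ fun k h => by omega) rfl rfl,
    if_congr (honly _ fun k h => by omega) rfl rfl,
    if_congr (honly _ fun k h => by omega) rfl rfl]
  have hmx : MeetsTrap α m x := hmeet m hx.1 hx.2
  have hmr : x < dWarm m → MeetsTrap α m (x + 1) := fun h => ⟨by omega, Or.inl (by omega)⟩
  have hml : dWarm m - eWarm α m < x → MeetsTrap α m (x - 1) :=
    fun h => ⟨by omega, Or.inl (by omega)⟩
  by_cases hmn : m = n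
  · subst hmn
    have hr : (if dWarm m - eWarm α m ≤ x ∧ x < dWarm m then
        β * (corePotential α β n₀ m (x + 1, 1) - corePotential α β n₀ m (x, 1)) else 0) =
        if x < dWarm m then β ^ (dWarm m - x) * (1 - β) else 0 := by
      by_cases h : x < dWarm m
      · rw [if_pos ⟨hx.1, h⟩, if_pos h, corePotential_entrance (hmr h),
          corePotential_entrance hmx, show dWarm m - (x + 1) = dWarm m - x - 1 by ring,
          zpow_sub_one₀ hβ0]
        field_simp
        ring
      · rw [if_neg (by omega), if_neg h]
    have hl : (if dWarm m - eWarm α m < x ∧ x ≤ dWarm m then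
        corePotential α β n₀ m (x - 1, 1) - corePotential α β n₀ m (x, 1) else 0) =
        if dWarm m - eWarm α m < x then β ^ (dWarm m - x) * (β - 1) else 0 := by
      by_cases h : dWarm m - eWarm α m < x
      · rw [if_pos ⟨h, hx.2⟩, if_pos h, corePotential_entrance (hml h),
          corePotential_entrance hmx, show dWarm m - (x - 1) = dWarm m - x + 1 by ring,
          zpow_add_one₀ hβ0]
        ring
      · rw [if_neg (by omega), if_neg h]
    have hu : (if x = dWarm m - eWarm α m then
        corePotential α β n₀ m (x, 2) - corePotential α β n₀ m (x, 1) else 0) =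
        if dWarm m - eWarm α m < x then 0 else β ^ (dWarm m - x) * (β - 1) := by
      by_cases h : dWarm m - eWarm α m < x
      · rw [if_neg (by omega), if_pos h]
      · rw [if_pos (by omega), if_neg h, corePotential_core hmx, corePotential_entrance hmx,
          show dWarm m - x = (eWarm α m : ℤ) by omega, zpow_natCast]
        ring
    have hdn : (if x = dWarm m then
        corePotential α β n₀ m (x, 0) - corePotential α β n₀ m (x, 1) else 0) =
        if x < dWarm m then 0 else β ^ (dWarm m - x) * (1 - β) := by
      by_cases h : x < dWarm m
      · rw [if_neg (by omega), if_pos h]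
      · obtain rfl : x = dWarm m := by omega
        rw [if_pos rfl, if_neg h, corePotential_axis, corePotential_entrance hmx]
        simp [axisProfile]
    rw [hr, hl, hu, hdn]
    split_ifs <;> linarith
  · have hval := fun {x' y' : ℤ} (h : MeetsTrap α m x') (hy : y' ≠ 0) =>
      hsep.corePotential_of_ne hn hm hmn h hy β
    refine le_of_eq ?_
    rw [hval hmx one_ne_zero, hval hmx two_ne_zero, corePotential_axis]
    have hr : (if dWarm m - eWarm α m ≤ x ∧ x < dWarm m then
        β * (corePotential α β n₀ n (x + 1, 1) - axisProfile β (dWarm n) (dWarm m))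
          else 0) = 0 :=
      ite_eq_right_iff.mpr fun h => by
        rw [hval (hmr h.2) one_ne_zero, sub_self, mul_zero]
    have hl : (if dWarm m - eWarm α m < x ∧ x ≤ dWarm m then
        corePotential α β n₀ n (x - 1, 1) - axisProfile β (dWarm n) (dWarm m) else 0) = 0 :=
      ite_eq_right_iff.mpr fun h => by rw [hval (hml h.1) one_ne_zero, sub_self]
    have hdn : (if x = dWarm m then
        axisProfile β (dWarm n) x - axisProfile β (dWarm n) (dWarm m) else 0) = 0 :=
      ite_eq_right_iff.mpr fun h => by rw [h, sub_self]
    rw [hr, hl, hdn]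
    simp

lemma WarmupSeparated.core_drift_le {α β : ℝ} {n₀ n : ℕ} (hsep : WarmupSeparated α n₀)
    (hn : n₀ ≤ n) {x : ℤ} (hxT : x ≠ dWarm n - eWarm α n) :
    ∑ w ∈ latNbrs (x, 2), stepWeight β (warmupEdges α n₀) (x, 2) w *
      (corePotential α β n₀ n w - corePotential α β n₀ n (x, 2)) ≤ 0 := by
  classical
  have hconst : ∀ {m : ℕ} {x' : ℤ}, n₀ ≤ m → MeetsTrap α m x → MeetsTrap α m x' →
      corePotential α β n₀ n (x', 2) = corePotential α β n₀ n (x, 2) := by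
    intro m x' hm h h'
    by_cases hmn : m = n
    · subst hmn
      rw [corePotential_core h, corePotential_core h']
    · rw [hsep.corePotential_of_ne hn hm hmn h two_ne_zero,
        hsep.corePotential_of_ne hn hm hmn h' two_ne_zero]
  refine le_of_eq (Finset.sum_eq_zero fun w hw => ?_)
  by_cases hwG : s(((x, 2) : V), w) ∈ warmupEdges α n₀
  swap
  · simp [stepWeight, hwG]
  suffices h : corePotential α β n₀ n w = corePotential α β n₀ n (x, 2) by
    rw [h, sub_self, mul_zero]
  simp only [latNbrs, Finset.mem_insert, Finset.mem_singleton] at hw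
  rcases hw with rfl | rfl | rfl | rfl
  · rw [mem_warmupEdges_horizontal] at hwG
    obtain h | ⟨m, hm, h⟩ := hwG
    · omega
    · exact hconst hm ⟨by omega, by omega⟩ ⟨by omega, by omega⟩
  · rw [mem_warmupEdges_left] at hwG
    obtain h | ⟨m, hm, h⟩ := hwG
    · omega
    · exact hconst hm ⟨by omega, by omega⟩ ⟨by omega, by omega⟩
  · rw [mem_warmupEdges_vertical] at hwG
    obtain ⟨m, hm, h⟩ := hwG
    omega
  · rw [mem_warmupEdges_down] at hwG
    obtain ⟨m, hm, h⟩ := hwG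
    have hmn : m ≠ n := by
      rintro rfl
      omega
    have hmx : MeetsTrap α m x := ⟨by omega, by omega⟩
    rw [hsep.corePotential_of_ne hn hm hmn hmx two_ne_zero,
      hsep.corePotential_of_ne hn hm hmn hmx (by norm_num)]

lemma WarmupSeparated.corePotential_drift_le {α β : ℝ} {n₀ n : ℕ}
    (hsep : WarmupSeparated α n₀) (hn₀ : 1 ≤ n₀) (hn : n₀ ≤ n) (hβ : 1 < β) {z : V}
    (hz : z ≠ (dWarm n - eWarm α n, 2)) :
    ∑ w ∈ latNbrs z, stepWeight β (warmupEdges α n₀) z w *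
      (corePotential α β n₀ n w - corePotential α β n₀ n z) ≤ 0 := by
  classical
  obtain ⟨x, y⟩ := z
  by_cases hy0 : y = 0
  · subst hy0
    exact hsep.axis_drift_le hn₀ hn hβ x
  by_cases hy1 : y = 1
  · subst hy1
    exact hsep.entrance_drift_le hn hβ x
  by_cases hy2 : y = 2
  · subst hy2
    exact hsep.core_drift_le hn fun h => hz (by rw [h])
  rw [drift_eq]
  simp [mem_warmupEdges_horizontal, mem_warmupEdges_left, mem_warmupEdges_vertical,
    mem_warmupEdges_down, hy0, hy1, hy2]

/-- In the warm-up configuration, the β-biased walk started at the origin ever visits the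
core vertex `(n³ - e_n, 2)` of the `n`'th trap with probability at most
`1/(β^{e_n+1}+β-2)`. -/
theorem total_time_in_core (α : ℝ) (hα : 0 < α) (n₀ : ℕ) (hn₀ : 1 ≤ n₀)
    (hsep : WarmupSeparated α n₀) (n : ℕ) (hn : n₀ ≤ n) (β : ℝ) (hβ : 1 < β)
    (μ : Measure (ℕ → V)) (hμ : IsWalkLaw β (warmupEdges α n₀) ((0, 0) : V) μ) :
    μ {ω | ∃ t : ℕ, ω t = ((dWarm n - eWarm α n, 2) : V)} ≤
      ENNReal.ofReal (1 / (β ^ (eWarm α n + 1) + β - 2)) := by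
  have hpow : 1 < β ^ (eWarm α n + 1) := one_lt_pow₀ hβ (Nat.succ_ne_zero _)
  have hsuper : ∀ z : V, z ≠ (dWarm n - eWarm α n, 2) →
      ∑' w, ENNReal.ofReal (transProb β (warmupEdges α n₀) z w) *
        ENNReal.ofReal (corePotential α β n₀ n w) ≤
          ENNReal.ofReal (corePotential α β n₀ n z) := fun z hz =>
    tsum_transProb_mul_le hβ _ z (fun _ => mem_latNbrs_of_mem_warmupEdges)
      (corePotential_nonneg hβ α n₀ n) (hsep.corePotential_drift_le hn₀ hn hβ hz)
  have hhit := hμ.mul_measure_hit_le hβ _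
    (fun z => ENNReal.ofReal (corePotential α β n₀ n z)) hsuper
  have hcore : MeetsTrap α n (dWarm n - eWarm α n) := ⟨le_rfl, Or.inl (by omega)⟩
  have hd : (0 : ℤ) ≤ dWarm n := by
    unfold dWarm
    positivity
  simp only [corePotential_core hcore, corePotential_axis, axisProfile, hd, if_true,
    ENNReal.ofReal_one] at hhit
  rw [one_div, ENNReal.ofReal_inv_of_pos (by linarith), ← one_div,
    ENNReal.le_div_iff_mul_le (Or.inl (by simpa using by linarith)) (Or.inl ENNReal.ofReal_ne_top),
    mul_comm]
  refine le_trans ?_ hhit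
  gcongr
  linarith

end
end

section
/- Let β > 1, θ ≥ 0, let Ψ be a translation invariant probability measure on {open, closed}^E, and let B be a measurable set of configurations such that: (i) lim_{t→∞} X_t/t = θ holds ℙ_{Ψ,β}-almost surely on the event B; and (ii) Ψ-almost surely on the event {0 ↔ ∞}, the open cluster of the origin contains a vertex z such that the configuration translated by −z belongs to B. Then lim_{t→∞} X_t/t = θ holds ℙ_{Ψ,β}-almost surely on the event {0 ↔ ∞}. -/
open MeasureTheory Filter
open scoped ENNReal

noncomputable section

/-- `f` is an edge of the square lattice ℤ². -/
def IsLatticeEdge (f : Sym2 V) : Prop := ∃ u v : V, latAdj u v ∧ f = s(u, v)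

/-- The edge set `E` of the square lattice. -/
abbrev Edge : Type := {f : Sym2 V // IsLatticeEdge f}

/-- A percolation configuration: an element of `{open, closed}^E`
(`true` = open, `false` = closed). -/
abbrev Config : Type := Edge → Bool

/-- Translating a lattice edge by the vector `v`. -/
def shiftEdge (v : V) (f : Edge) : Edge :=
  ⟨Sym2.map (· + v) f.1, by
    obtain ⟨u, w, huw, h⟩ := f.2
    refine ⟨u + v, w + v, ?_, ?_⟩
    · unfold latAdj at huw ⊢
      have h1 : (u + v).1 - (w + v).1 = u.1 - w.1 := by simp [Prod.fst_add]
      have h2 : (u + v).2 - (w + v).2 = u.2 - w.2 := by simp [Prod.snd_add]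
      rw [h1, h2]; exact huw
    · rw [h]; rfl⟩

/-- The shift action of ℤ² on configurations: `shiftCfg v cfg` is the configuration `cfg`
translated by `-v` (what `cfg` sees at the edge `f + v`, the shifted configuration sees
at `f`). -/
def shiftCfg (v : V) (cfg : Config) : Config := fun f => cfg (shiftEdge v f)

/-- Two vertices joined by an open edge of the configuration. -/
def openAdj (cfg : Config) (u w : V) : Prop := ∃ f : Edge, f.1 = s(u, w) ∧ cfg f = true

/-- The set of open edges of a configuration, as a subgraph of ℤ². -/
def openEdges (cfg : Config) : Set (Sym2 V) := {g : Sym2 V | ∃ f : Edge, f.1 = g ∧ cfg f = true}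

/-- The event `{0 ↔ ∞}`: the origin lies in an infinite open cluster. -/
def OriginInfinite (cfg : Config) : Prop :=
  {w : V | Relation.ReflTransGen (openAdj cfg) ((0, 0) : V) w}.Infinite

/-- A trajectory has asymptotic horizontal speed `θ`. -/
def HasSpeed (θ : ℝ) (ω : ℕ → V) : Prop :=
  Tendsto (fun t : ℕ => ((ω t).1 : ℝ) / t) atTop (nhds θ)

lemma measurableSet_hasSpeed (θ : ℝ) : MeasurableSet {ω | HasSpeed θ ω} := by
  refine measurableSet_tendsto (nhds θ) fun t => ?_
  have h : Measurable fun x : V => (x.1 : ℝ) / t := measurable_of_countable _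
  exact h.comp (measurable_pi_apply t)

lemma HasSpeed.shift {θ : ℝ} {ω : ℕ → V} (h : HasSpeed θ ω) :
    HasSpeed θ fun t => ω (t + 1) := by
  have h1 : Tendsto (fun t : ℕ => ((ω (t + 1)).1 : ℝ) / ((t + 1 : ℕ) : ℝ)) atTop (nhds θ) :=
    h.comp (tendsto_add_atTop_nat 1)
  have h2 : Tendsto (fun t : ℕ => 1 + 1 / (t : ℝ)) atTop (nhds (1 + 0)) :=
    tendsto_const_nhds.add tendsto_one_div_atTop_nhds_zero_nat
  have h3 := h1.mul h2
  rw [add_zero, mul_one] at h3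
  refine h3.congr' ?_
  filter_upwards [eventually_gt_atTop 0] with t ht
  have : (t : ℝ) ≠ 0 := by positivity
  push_cast
  field_simp

lemma HasSpeed.translate {θ : ℝ} {ω : ℕ → V} (h : HasSpeed θ ω) (z : V) :
    HasSpeed θ fun t => ω t + z := by
  have h3 := h.add (tendsto_const_div_atTop_nhds_zero_nat (z.1 : ℝ))
  rw [add_zero] at h3
  refine h3.congr fun t => ?_
  rw [Prod.fst_add]
  push_cast
  ring

lemma measurableSet_cylinder (n : ℕ) (f : ℕ → V) :
    MeasurableSet {ω : ℕ → V | ∀ i ≤ n, ω i = f i} := by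
  measurability

lemma IsWalkLaw.ae_start {β : ℝ} {G : Set (Sym2 V)} {z : V} {μ : Measure (ℕ → V)}
    (h : IsWalkLaw β G z μ) : ∀ᵐ ω ∂μ, ω 0 = z := by
  have := h.1
  have h0 := h.2 0 (fun _ => z) rfl
  have hm := measurableSet_cylinder 0 fun _ => z
  simp only [nonpos_iff_eq_zero, forall_eq, Finset.range_zero, Finset.prod_empty,
    ENNReal.ofReal_one] at h0 hm
  exact (prob_compl_eq_zero_iff hm).2 h0

/-- The cylinder probabilities determine the law of the walk. -/
lemma IsWalkLaw.unique {β : ℝ} {G : Set (Sym2 V)} {z : V} {μ ν : Measure (ℕ → V)}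
    (hμ : IsWalkLaw β G z μ) (hν : IsWalkLaw β G z ν) : μ = ν := by
  have := hμ.1
  have := hν.1
  have hfam : IsProjectiveMeasureFamily (fun I : Finset ℕ => ν.map I.restrict) := by
    intro I J hJI
    rw [Measure.map_map (by fun_prop) (by fun_prop)]
    rfl
  have hlim : IsProjectiveLimit ν (fun I : Finset ℕ => ν.map I.restrict) := fun _ => rfl
  have (I : Finset ℕ) : IsFiniteMeasure (ν.map I.restrict) := inferInstance
  refine IsProjectiveLimit.unique ((isProjectiveLimit_nat_iff hfam μ).2 fun n => ?_) hlim
  refine Measure.ext_of_singleton fun g => ?_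
  rw [Measure.map_apply (by fun_prop) (measurableSet_singleton g),
    Measure.map_apply (by fun_prop) (measurableSet_singleton g)]
  let f : ℕ → V := fun i => if hi : i ≤ n then g ⟨i, Finset.mem_Iic.2 hi⟩ else z
  have hset : Preorder.frestrictLe (π := fun _ => V) n ⁻¹' {g} = {ω | ∀ i ≤ n, ω i = f i} := by
    ext ω
    simp only [Set.mem_preimage, Set.mem_singleton_iff, Set.mem_ofPred_eq, funext_iff,
      Subtype.forall, Finset.mem_Iic]
    refine forall₂_congr fun i hi => ?_
    simp [f, hi]
  change μ (Preorder.frestrictLe (π := fun _ => V) n ⁻¹' {g}) =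
    ν (Preorder.frestrictLe (π := fun _ => V) n ⁻¹' {g})
  rw [hset]
  by_cases hf : f 0 = z
  · rw [hμ.2 n f hf, hν.2 n f hf]
  · have key {ρ : Measure (ℕ → V)} (hρ : IsWalkLaw β G z ρ) :
        ρ {ω | ∀ i ≤ n, ω i = f i} = 0 := by
      refine measure_eq_zero_iff_ae_notMem.2 (hρ.ae_start.mono fun ω h0 hω => hf ?_)
      rw [← hω 0 (Nat.zero_le n)]
      exact h0
    rw [key hμ, key hν]

/-- Markov property at time one: conditioning the walk on a first step of positive probability
to `w` and forgetting the starting point gives the walk from `w`. -/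
lemma IsWalkLaw.restrict_shift {β : ℝ} {G : Set (Sym2 V)} {z w : V} {μ : Measure (ℕ → V)}
    (h : IsWalkLaw β G z μ) (hp : 0 < transProb β G z w) :
    IsWalkLaw β G w ((ENNReal.ofReal (transProb β G z w))⁻¹ •
      (μ.restrict {ω | ω 1 = w}).map fun ω t => ω (t + 1)) := by
  have hshift : Measurable fun (ω : ℕ → V) t => ω (t + 1) := by fun_prop
  have hcyl (n : ℕ) (f : ℕ → V) (hf : f 0 = w) :
      (μ.restrict {ω | ω 1 = w}).map (fun ω t => ω (t + 1)) {ω | ∀ i ≤ n, ω i = f i} =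
        ENNReal.ofReal (transProb β G z w) *
          ENNReal.ofReal (∏ i ∈ Finset.range n, transProb β G (f i) (f (i + 1))) := by
    have hm := measurableSet_cylinder n f
    rw [Measure.map_apply hshift hm, Measure.restrict_apply (hshift hm)]
    let g : ℕ → V := fun i => Nat.casesOn i z f
    have hg := h.2 (n + 1) g rfl
    rw [Finset.prod_range_succ'] at hg
    rw [← ENNReal.ofReal_mul hp.le, mul_comm, ← hf]
    refine Eq.trans (measure_congr ?_) hg
    filter_upwards [h.ae_start] with ω hω
    refine propext ⟨fun h' i hi => ?_, fun h' => ⟨fun i hi => ?_, ?_⟩⟩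
    · cases i with
      | zero => exact hω
      | succ i => exact h'.1 i (Nat.le_of_succ_le_succ hi)
    · exact h' (i + 1) (Nat.succ_le_succ hi)
    · exact h' 1 (by omega)
  have hne : ENNReal.ofReal (transProb β G z w) ≠ 0 := (ENNReal.ofReal_pos.2 hp).ne'
  have hcyl' (n : ℕ) (f : ℕ → V) (hf : f 0 = w) :
      ((ENNReal.ofReal (transProb β G z w))⁻¹ •
        (μ.restrict {ω | ω 1 = w}).map fun ω t => ω (t + 1)) {ω | ∀ i ≤ n, ω i = f i} =
          ENNReal.ofReal (∏ i ∈ Finset.range n, transProb β G (f i) (f (i + 1))) := by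
    rw [Measure.smul_apply, hcyl n f hf, smul_eq_mul, ← mul_assoc,
      ENNReal.inv_mul_cancel hne ENNReal.ofReal_ne_top, one_mul]
  refine ⟨⟨?_⟩, hcyl'⟩
  have h1 := hcyl 0 (fun _ => w) rfl
  have hm := measurableSet_cylinder 0 fun _ => w
  rw [Measure.map_apply hshift hm, Measure.restrict_apply (hshift hm)] at h1
  rw [Measure.smul_apply, Measure.map_apply hshift .univ, Set.preimage_univ,
    Measure.restrict_apply_univ, smul_eq_mul]
  have hset : (fun (ω : ℕ → V) t => ω (t + 1)) ⁻¹' {ω | ∀ i ≤ 0, ω i = w} ∩ {ω | ω 1 = w} =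
      {ω | ω 1 = w} := by
    ext ω
    simp
  rw [hset, Finset.range_zero, Finset.prod_empty, ENNReal.ofReal_one, mul_one] at h1
  rw [h1, ENNReal.inv_mul_cancel hne ENNReal.ofReal_ne_top]

lemma mk_mem_openEdges {cfg : Config} {u w : V} : s(u, w) ∈ openEdges cfg ↔ openAdj cfg u w :=
  Iff.rfl

lemma openAdj.symm {cfg : Config} {u w : V} (h : openAdj cfg u w) : openAdj cfg w u := by
  rwa [← mk_mem_openEdges, Sym2.eq_swap]

lemma latAdj.symm {u w : V} (h : latAdj u w) : latAdj w u := by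
  unfold latAdj at *
  linarith

lemma openAdj.latAdj {cfg : Config} {u w : V} (h : openAdj cfg u w) : latAdj u w := by
  obtain ⟨⟨_, a, b, hab, rfl⟩, he, -⟩ := h
  rcases Sym2.eq_iff.1 he with ⟨rfl, rfl⟩ | ⟨rfl, rfl⟩
  · exact hab
  · exact hab.symm

lemma finite_openAdj (cfg : Config) (z : V) : {u : V | s(z, u) ∈ openEdges cfg}.Finite := by
  refine (Set.finite_Icc (z - (1, 1)) (z + (1, 1))).subset fun u hu => ?_
  have h : (z.1 - u.1) ^ 2 + (z.2 - u.2) ^ 2 = 1 := openAdj.latAdj hu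
  have h1 := abs_le.1 (abs_le_one_iff_mul_self_le_one.2
    (by nlinarith [sq_nonneg (z.2 - u.2)] : (z.1 - u.1) * (z.1 - u.1) ≤ 1))
  have h2 := abs_le.1 (abs_le_one_iff_mul_self_le_one.2
    (by nlinarith [sq_nonneg (z.1 - u.1)] : (z.2 - u.2) * (z.2 - u.2) ≤ 1))
  simp only [Set.mem_Icc, Prod.le_def, Prod.fst_sub, Prod.snd_sub, Prod.fst_add, Prod.snd_add]
  omega

lemma transProb_pos {β : ℝ} (hβ : 1 < β) {cfg : Config} {z w : V} (h : openAdj cfg z w) :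
    0 < transProb β (openEdges cfg) z w := by
  have hmem : w ∈ {u : V | s(z, u) ∈ openEdges cfg} := h
  have hcard : (0 : ℝ) < ({u : V | s(z, u) ∈ openEdges cfg}.ncard : ℝ) :=
    Nat.cast_pos.2 ((Set.ncard_pos (finite_openAdj cfg z)).2 ⟨w, hmem⟩)
  have hden : 0 < β + ({u : V | s(z, u) ∈ openEdges cfg}.ncard : ℝ) - 1 := by linarith
  rw [transProb, if_neg (Set.Nonempty.ne_empty ⟨w, hmem⟩), if_pos (mk_mem_openEdges.2 h)]
  split_ifs <;> positivity

lemma mk_mem_openEdges_shiftCfg {cfg : Config} {z u w : V} :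
    s(u, w) ∈ openEdges (shiftCfg z cfg) ↔ s(u + z, w + z) ∈ openEdges cfg := by
  constructor
  · rintro ⟨f, hf, ho⟩
    refine ⟨shiftEdge z f, ?_, ho⟩
    simp [shiftEdge, hf]
  · rintro h
    have hl : latAdj u w := by
      have := openAdj.latAdj h
      simpa [latAdj] using this
    obtain ⟨f, hf, ho⟩ := h
    refine ⟨⟨s(u, w), u, w, hl, rfl⟩, rfl, ?_⟩
    have : shiftEdge z ⟨s(u, w), u, w, hl, rfl⟩ = f := Subtype.ext (by simp [shiftEdge, hf])
    simpa [shiftCfg, this] using ho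

open scoped Classical in
lemma transProb_shiftCfg (β : ℝ) (cfg : Config) (z u w : V) :
    transProb β (openEdges (shiftCfg z cfg)) u w =
      transProb β (openEdges cfg) (u + z) (w + z) := by
  have himage : {x : V | s(u + z, x) ∈ openEdges cfg} =
      (· + z) '' {x : V | s(u, x) ∈ openEdges (shiftCfg z cfg)} := by
    ext x
    simp only [Set.mem_image, Set.mem_ofPred_eq, mk_mem_openEdges_shiftCfg]
    refine ⟨fun h => ⟨x - z, by simpa using h, by simp⟩, ?_⟩
    rintro ⟨y, hy, rfl⟩
    exact hy
  have hright : (((u + z).1 + 1, (u + z).2) : V) = (u.1 + 1, u.2) + z := by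
    ext <;> simp <;> ring
  have hcard := Set.ncard_image_of_injective
    {x : V | s(u, x) ∈ openEdges (shiftCfg z cfg)} (add_left_injective z)
  rw [← himage] at hcard
  have hempty : {x : V | s(u, x) ∈ openEdges (shiftCfg z cfg)} = ∅ ↔
      {x : V | s(u + z, x) ∈ openEdges cfg} = ∅ := by
    rw [himage, Set.image_eq_empty]
  rw [transProb, transProb, hcard, hright]
  exact if_congr hempty (if_congr (add_left_inj z).symm rfl rfl)
    (if_congr mk_mem_openEdges_shiftCfg
      (if_congr mk_mem_openEdges_shiftCfg (if_congr (add_left_inj z).symm rfl rfl) rfl) rfl)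

lemma measurable_translate (z : V) : Measurable fun (ω : ℕ → V) t => ω t + z :=
  measurable_pi_lambda _ fun t =>
    (measurable_of_countable fun x : V => x + z).comp (measurable_pi_apply t)

/-- Translating the walk on the shifted configuration back gives the walk from `z`. -/
lemma IsWalkLaw.translate {β : ℝ} {cfg : Config} {z : V} {μ : Measure (ℕ → V)}
    (h : IsWalkLaw β (openEdges (shiftCfg z cfg)) (0, 0) μ) :
    IsWalkLaw β (openEdges cfg) z (μ.map fun ω t => ω t + z) := by
  have := h.1
  refine ⟨Measure.isProbabilityMeasure_map (measurable_translate z).aemeasurable, fun n f hf => ?_⟩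
  rw [Measure.map_apply (measurable_translate z) (measurableSet_cylinder n f)]
  have hg := h.2 n (fun i => f i - z) (by rw [hf, sub_self]; rfl)
  simp only [transProb_shiftCfg, sub_add_cancel] at hg
  rw [← hg]
  congr 1
  ext ω
  simp [eq_sub_iff_add_eq]

/-- Almost sure speed propagates along open paths. -/
lemma exists_isWalkLaw_hasSpeed {β θ : ℝ} (hβ : 1 < β) {cfg : Config} {z w : V}
    (hzw : Relation.ReflTransGen (openAdj cfg) w z)
    (h : ∃ ν, IsWalkLaw β (openEdges cfg) z ν ∧ ∀ᵐ ω ∂ν, HasSpeed θ ω) :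
    ∃ ν, IsWalkLaw β (openEdges cfg) w ν ∧ ∀ᵐ ω ∂ν, HasSpeed θ ω := by
  induction hzw using Relation.ReflTransGen.head_induction_on with
  | refl => exact h
  | head huv _ ih =>
    obtain ⟨ν, hν, hs⟩ := ih
    refine ⟨_, hν.restrict_shift (transProb_pos hβ huv.symm), ?_⟩
    refine Measure.ae_smul_measure ?_ _
    have hshift : Measurable fun (ω : ℕ → V) t => ω (t + 1) := by fun_prop
    rw [ae_map_iff hshift.aemeasurable (measurableSet_hasSpeed θ)]
    exact (ae_restrict_of_ae hs).mono fun ω hω => hω.shift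

lemma measurable_shiftCfg (z : V) : Measurable (shiftCfg z) :=
  measurable_pi_lambda _ fun f => measurable_pi_apply (shiftEdge z f)

/-- Lemma 4.1 (reduction). If the β-biased walk from the origin has a.s. speed `θ` on
configurations in `B`, and if a.e. configuration whose origin-cluster is infinite contains
in that cluster a vertex `z` such that the configuration translated by `-z` lies in `B`,
then the walk from the origin has a.s. speed `θ` on the event `{0 ↔ ∞}`. -/
theorem reduction (β θ : ℝ) (hβ : 1 < β) (hθ : 0 ≤ θ)
    (Ψ : Measure Config) (hΨ : IsProbabilityMeasure Ψ)
    (hinv : ∀ v : V, Measure.map (shiftCfg v) Ψ = Ψ)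
    (B : Set Config) (hB : MeasurableSet B)
    (μ : Config → Measure (ℕ → V))
    (hμ : ∀ cfg : Config, IsWalkLaw β (openEdges cfg) ((0, 0) : V) (μ cfg))
    (hi : ∀ᵐ cfg ∂Ψ, cfg ∈ B →
      ∀ᵐ ω ∂(μ cfg), Tendsto (fun t : ℕ => ((ω t).1 : ℝ) / t) atTop (nhds θ))
    (hii : ∀ᵐ cfg ∂Ψ, OriginInfinite cfg →
      ∃ z : V, Relation.ReflTransGen (openAdj cfg) ((0, 0) : V) z ∧ shiftCfg z cfg ∈ B) :
    ∀ᵐ cfg ∂Ψ, OriginInfinite cfg →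
      ∀ᵐ ω ∂(μ cfg), Tendsto (fun t : ℕ => ((ω t).1 : ℝ) / t) atTop (nhds θ) := by
  have hshift : ∀ᵐ cfg ∂Ψ, ∀ z : V, shiftCfg z cfg ∈ B →
      ∀ᵐ ω ∂μ (shiftCfg z cfg), HasSpeed θ ω := by
    refine ae_all_iff.2 fun z => ?_
    rw [← hinv z] at hi
    exact ae_of_ae_map (measurable_shiftCfg z).aemeasurable hi
  filter_upwards [hshift, hii] with cfg hB' hii' hinf
  obtain ⟨z, hz, hzB⟩ := hii' hinf
  obtain ⟨ν, hν, hs⟩ := exists_isWalkLaw_hasSpeed (θ := θ) hβ hz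
    ⟨_, (hμ (shiftCfg z cfg)).translate,
      (ae_map_iff (measurable_translate z).aemeasurable (measurableSet_hasSpeed θ)).2
        ((hB' z hzB).mono fun ω hω => hω.translate z)⟩
  rw [(hμ cfg).unique hν]
  exact hs

end
end
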